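/- arXiv:1602.01880 — 18 statements merged into one kernel-verified Lean document; each statement's English description precedes it below -/
import Mathlib

section
/- Let Ψ be a finite reduced crystallographic root system spanning a finite-dimensional real vector space V, with Weyl group W, a fixed system of simple roots Ψ_s, and root lattice L equal to the ℤ-span of Ψ. If v ∈ V and w ∈ W satisfy w ≠ 1 and w(v) − v ∈ L, then there exist w' ∈ W and a simple root α ∈ Ψ_s such that s_α(w'(v)) − w'(v) ∈ L, where s_α is the reflection in α. -/
namespace RootPairing

open Set Submodule

variable {ι M N : Type*} [AddCommGroup M] [Module ℝ M] [AddCommGroup N] [Module ℝ N]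
  (P : RootPairing ι ℝ M N)

lemma eq_zero_of_forall_coroot'_eq_zero [P.IsRootSystem] {x : M}
    (h : ∀ i, P.coroot' i x = 0) : x = 0 := by
  have hx : P.toLinearMap x = 0 := by
    refine LinearMap.ext_on_range (IsRootSystem.span_coroot_eq_top (P := P)) fun i ↦ ?_
    simpa using h i
  exact P.toPerfPair.injective (by ext y; simpa using LinearMap.congr_fun hx y)

lemma reflection_mem_closure_range (i : ι) :
    P.reflection i ∈ Subgroup.closure (range P.reflection) :=
  Subgroup.subset_closure (mem_range_self i)

lemma list_prod_reflection_mem (l : List ι) :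
    (l.map P.reflection).prod ∈ Subgroup.closure (range P.reflection) := by
  refine list_prod_mem fun x hx ↦ ?_
  obtain ⟨i, -, rfl⟩ := List.mem_map.mp hx
  exact Subgroup.subset_closure (mem_range_self i)

lemma exists_apply_root_eq {w : M ≃ₗ[ℝ] M} (hw : w ∈ Subgroup.closure (range P.reflection))
    (i : ι) : ∃ k, w (P.root i) = P.root k := by
  induction hw using Subgroup.closure_induction'' generalizing i with
  | mem w hw =>
    obtain ⟨j, rfl⟩ := hw
    exact ⟨P.reflectionPerm j i, (P.root_reflectionPerm j i).symm⟩
  | inv_mem w hw =>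
    obtain ⟨j, rfl⟩ := hw
    exact ⟨P.reflectionPerm j i, (P.root_reflectionPerm j i).symm⟩
  | one => exact ⟨i, rfl⟩
  | mul a b _ _ ha hb =>
    obtain ⟨k, hk⟩ := hb i
    obtain ⟨l, hl⟩ := ha k
    exact ⟨l, by rw [LinearEquiv.mul_apply, hk, hl]⟩

lemma apply_mem_span_int {w : M ≃ₗ[ℝ] M} (hw : w ∈ Subgroup.closure (range P.reflection)) {x : M}
    (hx : x ∈ span ℤ (range P.root)) : w x ∈ span ℤ (range P.root) := by
  induction hx using span_induction with
  | mem x hx =>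
    obtain ⟨i, rfl⟩ := hx
    obtain ⟨k, hk⟩ := P.exists_apply_root_eq hw i
    exact hk ▸ subset_span (mem_range_self k)
  | zero => simp
  | add x y _ _ hx hy => simpa using add_mem hx hy
  | smul n x _ hx => simpa only [map_zsmul] using zsmul_mem hx n

section Form

variable [Fintype ι]

lemma rootForm_self_nonneg (x : M) : 0 ≤ P.RootForm x x := by
  rw [rootForm_apply_apply]
  exact Finset.sum_nonneg fun i _ ↦ mul_self_nonneg _

lemma eq_zero_of_rootForm_self_nonpos [P.IsRootSystem] {x : M} (h : P.RootForm x x ≤ 0) :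
    x = 0 := by
  refine P.eq_zero_of_forall_coroot'_eq_zero fun i ↦ ?_
  have h0 : P.RootForm x x = 0 := h.antisymm (P.rootForm_self_nonneg x)
  rw [rootForm_apply_apply, Finset.sum_eq_zero_iff_of_nonneg fun i _ ↦ mul_self_nonneg _] at h0
  simpa using h0 i (Finset.mem_univ i)

lemma rootForm_apply_root_self_pos (i : ι) : 0 < P.RootForm (P.root i) (P.root i) := by
  rw [rootForm_apply_apply]
  refine Finset.sum_pos' (fun j _ ↦ mul_self_nonneg _) ⟨i, Finset.mem_univ i, ?_⟩
  simp

lemma two_mul_rootForm_apply_root (x : M) (i : ι) :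
    2 * P.RootForm x (P.root i) = P.coroot' i x * P.RootForm (P.root i) (P.root i) := by
  have h := P.rootForm_reflection_reflection_apply i x (P.root i)
  rw [reflection_apply_self, reflection_apply] at h
  simp only [map_neg, map_sub, map_smul, LinearMap.sub_apply, LinearMap.smul_apply,
    smul_eq_mul] at h
  linarith

lemma rootForm_apply_root_pos_iff (x : M) (i : ι) :
    0 < P.RootForm x (P.root i) ↔ 0 < P.coroot' i x := by
  have h := P.two_mul_rootForm_apply_root x i
  have hi := P.rootForm_apply_root_self_pos i
  constructor <;> intro h0 <;> by_contra! h1 <;> nlinarith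

lemma rootForm_apply_apply_of_mem_closure {w : M ≃ₗ[ℝ] M}
    (hw : w ∈ Subgroup.closure (range P.reflection)) (x y : M) :
    P.RootForm (w x) (w y) = P.RootForm x y := by
  induction hw using Subgroup.closure_induction generalizing x y with
  | mem w hw => obtain ⟨i, rfl⟩ := hw; simp
  | one => simp
  | mul a b _ _ ha hb => simp [ha, hb]
  | inv a _ ha => rw [← ha]; simp

lemma coroot'_apply_of_apply_root_eq {w : M ≃ₗ[ℝ] M}
    (hw : w ∈ Subgroup.closure (range P.reflection)) {i j : ι} (h : w (P.root i) = P.root j)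
    (x : M) : P.coroot' j (w x) = P.coroot' i x := by
  have h1 := P.two_mul_rootForm_apply_root (w x) j
  rw [← h, P.rootForm_apply_apply_of_mem_closure hw, P.rootForm_apply_apply_of_mem_closure hw,
    P.two_mul_rootForm_apply_root] at h1
  exact (mul_right_cancel₀ (P.rootForm_apply_root_self_pos i).ne' h1).symm

/-- Elements of the Weyl group conjugate reflections to reflections. -/
lemma mul_reflection_of_apply_root_eq {w : M ≃ₗ[ℝ] M}
    (hw : w ∈ Subgroup.closure (range P.reflection)) {i j : ι} (h : w (P.root i) = P.root j) :
    w * P.reflection i = P.reflection j * w := by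
  ext x
  simp [reflection_apply, P.coroot'_apply_of_apply_root_eq hw h, h]

end Form

section Lattice

lemma exists_list_of_mem_span_int {x : M} (hx : x ∈ span ℤ (range P.root)) :
    ∃ l : List ι, (l.map P.root).sum = x := by
  rw [← mem_toAddSubgroup, span_int_eq_addSubgroupClosure] at hx
  induction hx using AddSubgroup.closure_induction with
  | mem x hx => obtain ⟨i, rfl⟩ := hx; exact ⟨[i], by simp⟩
  | zero => exact ⟨[], rfl⟩
  | add x y _ _ hx hy =>
    obtain ⟨l, rfl⟩ := hx
    obtain ⟨m, rfl⟩ := hy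
    exact ⟨l ++ m, by simp⟩
  | neg x _ hx =>
    obtain ⟨l, rfl⟩ := hx
    refine ⟨l.map fun i ↦ P.reflectionPerm i i, ?_⟩
    clear * -
    induction l with
    | nil => simp
    | cons i l ih => simp_all [add_comm]

lemma exists_int_coroot'_eq_of_mem_span_int [P.IsCrystallographic] {x : M}
    (hx : x ∈ span ℤ (range P.root)) (i : ι) : ∃ k : ℤ, P.coroot' i x = k := by
  induction hx using span_induction with
  | mem x hx =>
    obtain ⟨j, rfl⟩ := hx
    exact ⟨P.pairingIn ℤ j i, by simpa using (P.algebraMap_pairingIn ℤ j i).symm⟩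
  | zero => exact ⟨0, by simp⟩
  | add x y _ _ hx hy =>
    obtain ⟨k, hk⟩ := hx
    obtain ⟨m, hm⟩ := hy
    exact ⟨k + m, by simp only [map_add, hk, hm, Int.cast_add]⟩
  | smul n x _ hx =>
    obtain ⟨k, hk⟩ := hx
    exact ⟨n * k, by simp only [map_zsmul, hk, zsmul_eq_mul, Int.cast_mul]⟩

variable [Finite ι]

/-- A minuscule element of the root lattice vanishes. -/
lemma eq_zero_of_mem_span_int_of_forall_coroot'_le_one [P.IsRootSystem] [P.IsCrystallographic]
    {x : M} (hx : x ∈ span ℤ (range P.root)) (h : ∀ i, P.coroot' i x ≤ 1) : x = 0 := by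
  classical
  have := Fintype.ofFinite ι
  obtain ⟨l, hl⟩ := P.exists_list_of_mem_span_int hx
  generalize hn : l.length = n
  induction n generalizing x l with
  | zero => simp_all
  | succ n ih =>
    by_cases hpos : ∃ i ∈ l, 0 < P.RootForm x (P.root i)
    · obtain ⟨i, hil, hi⟩ := hpos
      obtain ⟨k, hk⟩ := P.exists_int_coroot'_eq_of_mem_span_int hx i
      have hi1 : P.coroot' i x = 1 := by
        rw [rootForm_apply_root_pos_iff] at hi
        have := h i
        rw [hk] at hi this ⊢
        norm_cast at hi this ⊢
        lia
      have hr : P.reflection i x = x - P.root i := by rw [reflection_apply, hi1, one_smul]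
      suffices P.reflection i x = 0 by simpa using this
      refine ih (x := P.reflection i x) ?_ (fun j ↦ ?_) (l.erase i) ?_ ?_
      · rw [hr]
        exact sub_mem hx (subset_span (mem_range_self i))
      · rw [coroot'_reflection]
        exact h _
      · rw [hr, ← hl, ((List.perm_cons_erase hil).map P.root).sum_eq]
        simp
      · rw [List.length_erase_of_mem hil, hn, Nat.add_sub_cancel]
    · push Not at hpos
      apply P.eq_zero_of_rootForm_self_nonpos
      nth_rw 2 [← hl]
      rw [map_list_sum, List.map_map]
      simpa using List.sum_le_card_nsmul (l.map (P.RootForm x ∘ P.root)) 0 (by simpa using hpos)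

/-- Every coset of the root lattice contains a point of minimal length. -/
lemma exists_mem_span_int_forall_rootForm_le [Fintype ι] [P.IsRootSystem] [P.IsCrystallographic]
    (v : M) : ∃ x ∈ span ℤ (range P.root), ∀ y ∈ span ℤ (range P.root),
      P.RootForm (v + x) (v + x) ≤ P.RootForm (v + y) (v + y) := by
  set K := P.RootForm v v with hK
  let A : Set M := {x | x ∈ span ℤ (range P.root) ∧ P.RootForm (v + x) (v + x) ≤ K}
  choose! n hn using fun (x : M) (hx : x ∈ span ℤ (range P.root)) ↦
    P.exists_int_coroot'_eq_of_mem_span_int hx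
  have hA : A.Finite := by
    have hinj : InjOn n A := fun x hx y hy hxy ↦ by
      rw [← sub_eq_zero]
      refine P.eq_zero_of_forall_coroot'_eq_zero fun i ↦ ?_
      rw [map_sub, hn x hx.1, hn y hy.1, hxy, sub_self]
    refine Finite.of_finite_image (Finite.subset
      (Finite.pi (t := fun i ↦ Set.Icc ⌊-(K + 1) - P.coroot' i v⌋ ⌈K + 1 - P.coroot' i v⌉)
        fun i ↦ Set.finite_Icc _ _) ?_) hinj
    rintro - ⟨x, ⟨hx, hxK⟩, rfl⟩ i -
    have hsq : P.coroot' i (v + x) * P.coroot' i (v + x) ≤ K := by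
      rw [rootForm_apply_apply] at hxK
      exact (Finset.single_le_sum (f := fun i ↦ P.coroot' i (v + x) * P.coroot' i (v + x))
        (fun j _ ↦ mul_self_nonneg _) (Finset.mem_univ i)).trans hxK
    rw [map_add, hn x hx i] at hsq
    have h1 : -(K + 1) ≤ P.coroot' i v + n x i := by nlinarith
    have h2 : P.coroot' i v + n x i ≤ K + 1 := by nlinarith
    constructor
    · exact_mod_cast (Int.floor_le _).trans (by linarith : _ ≤ (n x i : ℝ))
    · exact_mod_cast (by linarith : (n x i : ℝ) ≤ _).trans (Int.le_ceil _)
  obtain ⟨x, hx, hmin⟩ := Set.exists_min_image A (fun x ↦ P.RootForm (v + x) (v + x)) hA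
    ⟨0, zero_mem _, by simp [hK]⟩
  refine ⟨x, hx.1, fun y hy ↦ ?_⟩
  by_cases hyK : P.RootForm (v + y) (v + y) ≤ K
  · exact hmin y ⟨hy, hyK⟩
  · exact hx.2.trans (le_of_not_ge hyK)

end Lattice

section WeylGroup

variable {P} [Finite ι]

lemma Base.reflection_mem_closure_of_support [P.IsReduced] [P.IsCrystallographic] (b : P.Base) (i : ι) :
    P.reflection i ∈ Subgroup.closure (P.reflection '' b.support) := by
  induction i using b.induction_reflect with
  | h₀ i hi =>
    rw [reflection_reflectionPerm]
    exact mul_mem (mul_mem hi hi) hi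
  | h₁ i hi => exact Subgroup.subset_closure ⟨i, hi, rfl⟩
  | h₂ i j hi hj =>
    have hj' : P.reflection j ∈ Subgroup.closure (P.reflection '' b.support) :=
      Subgroup.subset_closure ⟨j, hj, rfl⟩
    rw [reflection_reflectionPerm]
    exact mul_mem (mul_mem hj' hi) hj'

lemma Base.exists_list_of_mem_closure_reflection [P.IsReduced] [P.IsCrystallographic] (b : P.Base)
    {w : M ≃ₗ[ℝ] M} (hw : w ∈ Subgroup.closure (range P.reflection)) :
    ∃ l : List ι, (∀ i ∈ l, i ∈ b.support) ∧ (l.map P.reflection).prod = w := by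
  replace hw : w ∈ Subgroup.closure (P.reflection '' b.support) := by
    refine (Subgroup.closure_le _).mpr ?_ hw
    rintro - ⟨i, rfl⟩
    exact b.reflection_mem_closure_of_support i
  induction hw using Subgroup.closure_induction with
  | mem w hw => obtain ⟨i, hi, rfl⟩ := hw; exact ⟨[i], by simpa using hi, by simp⟩
  | one => exact ⟨[], by simp, rfl⟩
  | mul x y _ _ hx hy =>
    obtain ⟨l, hl, rfl⟩ := hx
    obtain ⟨m, hm, rfl⟩ := hy
    exact ⟨l ++ m, by simpa [or_imp, forall_and] using ⟨hl, hm⟩, by simp⟩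
  | inv x _ hx =>
    obtain ⟨l, hl, rfl⟩ := hx
    refine ⟨l.reverse, by simpa using hl, ?_⟩
    rw [List.prod_inv_reverse, List.map_map, List.map_reverse]
    rfl

/-- The exchange condition. -/
lemma Base.exists_list_mul_reflection_eq [P.IsCrystallographic] [P.IsReduced] (b : P.Base)
    {i k : ι} (hi : i ∈ b.support) (l : List ι) (hl : ∀ j ∈ l, j ∈ b.support)
    (hk : (l.map P.reflection).prod (P.root i) = P.root k) (hneg : ¬ b.IsPos k) :
    ∃ m : List ι, (∀ j ∈ m, j ∈ b.support) ∧ m.length + 1 = l.length ∧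
      (l.map P.reflection).prod * P.reflection i = (m.map P.reflection).prod := by
  have := Fintype.ofFinite ι
  induction l generalizing k with
  | nil =>
    obtain rfl : i = k := P.root.injective (by simpa using hk)
    exact absurd (isPos_of_mem_support hi) hneg
  | cons a t ih =>
    simp only [List.mem_cons, forall_eq_or_imp] at hl
    simp only [List.map_cons, List.prod_cons, LinearEquiv.mul_apply] at hk ⊢
    have hm : (t.map P.reflection).prod (P.root i) = P.root (P.reflectionPerm a k) := by
      rw [root_reflectionPerm, ← hk]
      simp
    by_cases hpos : b.IsPos (P.reflectionPerm a k)
    · have ha : P.reflectionPerm a k = a := by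
        by_contra hne
        exact hneg (by simpa using hpos.reflectionPerm hl.1 hne)
      rw [ha] at hm
      refine ⟨t, hl.2, by simp, ?_⟩
      rw [mul_assoc, P.mul_reflection_of_apply_root_eq (P.list_prod_reflection_mem t) hm,
        ← mul_assoc]
      ext x
      simp
    · obtain ⟨m, hm, hlen, h⟩ := ih hl.2 hm hpos
      exact ⟨a :: m, by simpa using ⟨hl.1, hm⟩, by simpa using hlen, by simp [mul_assoc, h]⟩

/-- An element of the Weyl group preserving the set of positive roots is trivial. -/
lemma Base.eq_one_of_forall_isPos [P.IsCrystallographic] [P.IsReduced] (b : P.Base)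
    {w : M ≃ₗ[ℝ] M} (hw : w ∈ Subgroup.closure (range P.reflection))
    (h : ∀ i k, b.IsPos i → w (P.root i) = P.root k → b.IsPos k) : w = 1 := by
  obtain ⟨l, hl, rfl⟩ := b.exists_list_of_mem_closure_reflection hw
  clear hw
  generalize hn : l.length = n
  induction n using Nat.strong_induction_on generalizing l with
  | h n ih =>
    rcases l.eq_nil_or_concat with rfl | ⟨t, i, rfl⟩
    · rfl
    · simp only [List.concat_eq_append, List.mem_append, List.mem_singleton, or_imp,
        forall_and, forall_eq] at hl
      have hprod : ((t.concat i).map P.reflection).prod =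
          (t.map P.reflection).prod * P.reflection i := by simp
      rw [hprod] at h ⊢
      obtain ⟨k, hk⟩ := P.exists_apply_root_eq (P.list_prod_reflection_mem t) i
      have hneg : ¬ b.IsPos k := by
        rw [← IsPos.neg_iff_not]
        refine h i _ (isPos_of_mem_support hl.2) ?_
        simp [LinearEquiv.mul_apply, hk]
      obtain ⟨m, hm, hlen, heq⟩ := b.exists_list_mul_reflection_eq hl.2 t hl.1 hk hneg
      rw [heq] at h ⊢
      refine ih m.length ?_ m hm h rfl
      simp at hn
      lia

variable (P) in
/-- The Weyl group acts freely on the set of regular points. -/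
lemma eq_one_of_apply_eq_self [P.IsRootSystem] [P.IsCrystallographic] [P.IsReduced]
    {w : M ≃ₗ[ℝ] M} (hw : w ∈ Subgroup.closure (range P.reflection)) {v : M}
    (hv : ∀ i, P.coroot' i v ≠ 0) (hwv : w v = v) : w = 1 := by
  have := Fintype.ofFinite ι
  let := P.indexNeg
  let f : Module.Dual ℝ M := P.RootForm v
  have hf (i : ι) : f (P.root i) ≠ 0 := fun h0 ↦ hv i <| by
    have h := P.two_mul_rootForm_apply_root v i
    rw [show P.RootForm v (P.root i) = 0 from h0, mul_zero, eq_comm, mul_eq_zero] at h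
    exact h.resolve_right (P.rootForm_apply_root_self_pos i).ne'
  let s : Set ι := IsAddIndecomposable.baseOf P.root (f : M →+ ℝ)
  have hs (i) (hi : i ∈ s) : 0 < f (P.root i) :=
    hi.1
  let b : P.Base := Base.mk' P s (P.linearIndepOn_root_baseOf' f hf) fun i ↦
    IsAddIndecomposable.mem_or_neg_mem_closure_baseOf P.root (f : M →+ ℝ) i (hf i) (by simp)
  have hb (i) (hi : b.IsPos i) : 0 < f (P.root i) := by
    refine hi.induction_on_add (p := fun i ↦ 0 < f (P.root i))
      (fun j hj ↦ hs j ((Set.toFinite s).mem_toFinset.mp hj)) fun i j k hk hi hj ↦ ?_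
    rw [hk, map_add]
    exact add_pos hi (hs j ((Set.toFinite s).mem_toFinset.mp hj))
  refine b.eq_one_of_forall_isPos hw fun i k hi hik ↦ ?_
  by_contra hk
  rw [← Base.IsPos.neg_iff_not] at hk
  have h1 := hb i hi
  have h2 := hb _ hk
  have h3 : f (P.root k) = f (P.root i) := by
    simp only [f]
    rw [← hik]
    nth_rw 1 [← hwv]
    exact P.rootForm_apply_apply_of_mem_closure hw _ _
  simp at h2
  linarith

variable (P) in
/-- If an element of the affine Weyl group with nontrivial linear part fixes `v`, then `v` lies on
an affine reflecting hyperplane. -/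
lemma exists_coroot'_eq_int [P.IsRootSystem] [P.IsCrystallographic] [P.IsReduced]
    {w : M ≃ₗ[ℝ] M} (hw : w ∈ Subgroup.closure (range P.reflection)) (hw1 : w ≠ 1) {v : M}
    (hwv : w v - v ∈ span ℤ (range P.root)) : ∃ i, ∃ k : ℤ, P.coroot' i v = k := by
  have := Fintype.ofFinite ι
  by_contra! hne
  obtain ⟨x, hx, hmin⟩ := P.exists_mem_span_int_forall_rootForm_le v
  have hne' (i : ι) (k : ℤ) : P.coroot' i (v + x) ≠ k := fun h ↦ by
    obtain ⟨m, hm⟩ := P.exists_int_coroot'_eq_of_mem_span_int hx i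
    refine hne i (k - m) ?_
    rw [map_add, hm] at h
    push_cast
    linarith
  have hlt (i : ι) : P.coroot' i (v + x) < 1 := by
    refine lt_of_le_of_ne ?_ (by simpa using hne' i 1)
    have h1 := hmin (x - P.root i) (sub_mem hx (subset_span (mem_range_self i)))
    have h2 := P.two_mul_rootForm_apply_root (v + x) i
    have h3 : P.RootForm (P.root i) (v + x) = P.RootForm (v + x) (P.root i) :=
      P.rootForm_symmetric.eq _ _
    have h4 := P.rootForm_apply_root_self_pos i
    rw [← add_sub_assoc] at h1
    generalize v + x = u at *
    simp only [map_sub, LinearMap.sub_apply] at h1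
    by_contra! h5
    nlinarith
  have hgt (i : ι) : -1 < P.coroot' i (v + x) := by
    have h := hlt (P.reflectionPerm i i)
    rw [← coroot'_reflection, reflection_apply, map_sub, map_smul, root_coroot'_eq_pairing,
      pairing_same, smul_eq_mul] at h
    linarith
  have hmem : w (v + x) - (v + x) ∈ span ℤ (range P.root) := by
    have : w (v + x) - (v + x) = (w v - v) + (w x - x) := by rw [map_add]; abel
    rw [this]
    exact add_mem hwv (sub_mem (P.apply_mem_span_int hw hx) hx)
  have hfix : w (v + x) - (v + x) = 0 := by
    refine P.eq_zero_of_mem_span_int_of_forall_coroot'_le_one hmem fun i ↦ ?_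
    obtain ⟨k, hk⟩ := P.exists_int_coroot'_eq_of_mem_span_int hmem i
    obtain ⟨j, hj⟩ := P.exists_apply_root_eq (inv_mem hw) i
    have hji : w (P.root j) = P.root i := by rw [← hj]; simp
    have hk2 : (k : ℝ) < 2 := by
      rw [← hk, map_sub, P.coroot'_apply_of_apply_root_eq hw hji]
      linarith [hlt j, hgt i]
    rw [hk]
    norm_cast at hk2 ⊢
    lia
  exact hw1 <| P.eq_one_of_apply_eq_self hw (fun i ↦ by simpa using hne' i 0)
    (sub_eq_zero.mp hfix)

lemma Base.exists_mem_closure_apply_root_eq [P.IsReduced] [P.IsCrystallographic] (b : P.Base)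
    (i : ι) : ∃ w ∈ Subgroup.closure (range P.reflection), ∃ j ∈ b.support,
      w (P.root i) = P.root j := by
  induction i using b.induction_reflect with
  | h₀ i hi =>
    obtain ⟨w, hw, j, hj, h⟩ := hi
    refine ⟨w * P.reflection i, mul_mem hw (P.reflection_mem_closure_range i), j, hj, ?_⟩
    rw [root_reflectionPerm, LinearEquiv.mul_apply]
    simpa using h
  | h₁ i hi => exact ⟨1, one_mem _, i, hi, rfl⟩
  | h₂ i k hi hk =>
    obtain ⟨w, hw, j, hj, h⟩ := hi
    refine ⟨w * P.reflection k, mul_mem hw (P.reflection_mem_closure_range k), j, hj, ?_⟩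
    rw [root_reflectionPerm, LinearEquiv.mul_apply]
    simpa using h

theorem Base.exists_reflection_apply_sub_self_mem_span_int [P.IsRootSystem] [P.IsCrystallographic]
    [P.IsReduced] (b : P.Base) {w : M ≃ₗ[ℝ] M} (hw : w ∈ Subgroup.closure (range P.reflection))
    (hw1 : w ≠ 1) {v : M} (hwv : w v - v ∈ span ℤ (range P.root)) :
    ∃ w' ∈ Subgroup.closure (range P.reflection), ∃ j ∈ b.support,
      P.reflection j (w' v) - w' v ∈ span ℤ (range P.root) := by
  have := Fintype.ofFinite ι
  obtain ⟨i, k, hk⟩ := P.exists_coroot'_eq_int hw hw1 hwv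
  obtain ⟨w', hw', j, hj, h⟩ := b.exists_mem_closure_apply_root_eq i
  refine ⟨w', hw', j, hj, ?_⟩
  rw [reflection_apply, P.coroot'_apply_of_apply_root_eq hw' h, hk, sub_sub_cancel_left,
    Int.cast_smul_eq_zsmul]
  exact neg_mem (zsmul_mem (subset_span (mem_range_self j)) k)

end WeylGroup

end RootPairing

/-- Lemma 3.12: if `w ∈ W`, `w ≠ 1` and `w(v) - v` lies in the root lattice `L`,
then some Weyl translate of `v` is moved into `L` by a *simple* reflection. -/
theorem stmt0
    {V : Type*} [AddCommGroup V] [Module ℝ V] [FiniteDimensional ℝ V]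
    (Ψ : Finset V)
    (hspan : Submodule.span ℝ (Ψ : Set V) = ⊤)
    (coroot : V → Module.Dual ℝ V)
    (h2 : ∀ α ∈ Ψ, coroot α α = 2)
    (hcrys : ∀ α ∈ Ψ, ∀ β ∈ Ψ, ∃ k : ℤ, coroot α β = (k : ℝ))
    (hred : ∀ α ∈ Ψ, ∀ c : ℝ, c • α ∈ (Ψ : Set V) → c = 1 ∨ c = -1)
    (s : V → (V ≃ₗ[ℝ] V))
    (hs : ∀ α ∈ Ψ, ∀ x : V, s α x = x - coroot α x • α)
    (hstab : ∀ α ∈ Ψ, ∀ β ∈ Ψ, s α β ∈ Ψ)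
    (S : Finset V) (hSsub : S ⊆ Ψ)
    (hSind : LinearIndependent ℝ (fun α : (S : Set V) => (α : V)))
    (hbase : ∀ β ∈ Ψ, ∃ c : V → ℤ,
      β = ∑ α ∈ S, (c α : ℝ) • α ∧
      ((∀ α ∈ S, 0 ≤ c α) ∨ (∀ α ∈ S, c α ≤ 0)))
    (v : V) (w : V ≃ₗ[ℝ] V)
    (hwW : w ∈ Subgroup.closure (s '' (Ψ : Set V)))
    (hw1 : w ≠ 1)
    (hwv : w v - v ∈ Submodule.span ℤ (Ψ : Set V)) :
    ∃ w' ∈ Subgroup.closure (s '' (Ψ : Set V)), ∃ α ∈ S,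
      s α (w' v) - w' v ∈ Submodule.span ℤ (Ψ : Set V) := by
  have hrange : Set.range (Subtype.val : Ψ → V) = (Ψ : Set V) := by simp
  have hmaps (α : V) (hα : α ∈ Ψ) :
      Set.MapsTo (Module.preReflection α (coroot α)) (Ψ : Set V) (Ψ : Set V) := fun β hβ ↦ by
    simpa [Module.preReflection_apply, hs α hα] using hstab α hα β hβ
  have hcoroot : Function.Injective fun α : Ψ ↦ coroot α := fun ⟨α, hα⟩ ⟨β, hβ⟩ h ↦ by
    simp only at h
    have : IsAddTorsionFree V := .of_isTorsionFree ℝ V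
    exact Subtype.ext <| Module.eq_of_mapsTo_reflection_of_mem Ψ.finite_toSet (h2 α hα) (h2 β hβ)
      (by rw [← h, h2 α hα]) (by rw [h, h2 β hβ]) (hmaps α hα) (hmaps β hβ) hβ
  let P : RootPairing Ψ ℝ V (Module.Dual ℝ V) :=
    .mk'' (Module.Dual.eval ℝ V) (.subtype _) ⟨fun α : Ψ ↦ coroot α, hcoroot⟩
      (fun α ↦ h2 α α.2) (fun α ↦ by
        rw [show Set.range (Function.Embedding.subtype _) = (Ψ : Set V) from hrange]
        exact hmaps α α.2) (by simpa using hspan)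
  have hroot (α : Ψ) : P.root α = α := rfl
  have hrangeP : Set.range P.root = (Ψ : Set V) := hrange
  have hP : P.IsRootSystem := RootPairing.isRootSystem_mk'' fun α β ↦
    (hcrys β β.2 α α.2).imp fun k hk ↦ hk.symm
  have hPcrys : P.IsCrystallographic := ⟨fun α β ↦
    (hcrys β β.2 α α.2).imp fun k hk ↦ hk.symm⟩
  have hPred : P.IsReduced := ⟨fun α β h ↦ by
    rw [LinearIndependent.pair_iff' (P.ne_zero α)] at h
    push Not at h
    obtain ⟨c, hc⟩ := h
    rcases hred α α.2 c (by rw [← hroot, hc]; exact β.2) with rfl | rfl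
    · left; simpa using hc
    · right; rw [← hc]; simp⟩
  have hrefl (α : Ψ) : P.reflection α = s α := by
    ext x
    rw [hs α α.2]
    rfl
  have hW : Set.range P.reflection = s '' (Ψ : Set V) := by
    rw [← hrange, ← Set.range_comp]
    exact congrArg Set.range (funext hrefl)
  let S' : Set Ψ := {α | (α : V) ∈ S}
  have hS' : P.root '' S' = (S : Set V) := by
    ext x
    simp only [S', Set.mem_image, Set.mem_ofPred_eq]
    exact ⟨fun ⟨α, hα, h⟩ ↦ h ▸ hα, fun hx ↦ ⟨⟨x, hSsub hx⟩, hx, rfl⟩⟩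
  let b : P.Base := RootPairing.Base.mk' P S'
    (by
      rw [linearIndepOn_iff_image P.root.injective.injOn, hS']
      exact hSind)
    (fun β ↦ by
      have hsum (c : V → ℤ) (hc : ∀ α ∈ S, 0 ≤ c α) :
          ∑ α ∈ S, (c α : ℝ) • α ∈ AddSubmonoid.closure (S : Set V) := by
        refine sum_mem fun α hα ↦ ?_
        lift c α to ℕ using hc α hα with n
        simpa [Nat.cast_smul_eq_nsmul] using nsmul_mem (AddSubmonoid.subset_closure hα) n
      rw [hS', hroot]
      obtain ⟨c, hβ, hc | hc⟩ := hbase β β.2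
      · exact .inl (hβ ▸ hsum c hc)
      · right
        rw [hβ]
        simpa using hsum (-c) (by simpa using hc))
  rw [← hW] at hwW ⊢
  rw [← hrangeP] at hwv ⊢
  obtain ⟨w', hw', α, hα, h⟩ := b.exists_reflection_apply_sub_self_mem_span_int hwW hw1 hwv
  exact ⟨w', hw', α, (Set.toFinite S').mem_toFinset.mp hα, hrefl α ▸ h⟩
end

section
/- Let r ≥ 1 and let n ≥ r + 3 be an integer. If σ is a permutation of {0, 1, …, r} such that the integers i − σ(i) (for 0 ≤ i ≤ r) are pairwise congruent modulo n, then σ is the identity. -/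
/-- Lemma 4.5: for `n ≥ r + 3`, if the integers `i - σ(i)` are pairwise
congruent mod `n`, then `σ = 1`. -/
theorem stmt2 (r n : ℕ) (hr : 1 ≤ r) (hn : r + 3 ≤ n)
    (σ : Equiv.Perm (Fin (r + 1)))
    (h : ∀ i j : Fin (r + 1),
      (n : ℤ) ∣ (((i : ℕ) : ℤ) - ((σ i : ℕ) : ℤ)) - (((j : ℕ) : ℤ) - ((σ j : ℕ) : ℤ))) :
    σ = 1 := by
  have step (k : ℕ) (hk : k + 1 < r + 1) :
      (σ ⟨k + 1, hk⟩ : ℕ) = σ ⟨k, by omega⟩ + 1 := by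
    have hd := h ⟨k + 1, hk⟩ ⟨k, by omega⟩
    have h₁ := (σ ⟨k + 1, hk⟩).isLt
    have h₂ := (σ ⟨k, by omega⟩).isLt
    have h₀ := Int.eq_zero_of_abs_lt_dvd hd (by rw [abs_lt]; push_cast; omega)
    push_cast at h₀
    omega
  have shift (k : ℕ) (hk : k < r + 1) : (σ ⟨k, hk⟩ : ℕ) = σ 0 + k := by
    induction k with
    | zero => rfl
    | succ k ih => rw [step k hk, ih (by omega), add_assoc]
  have hlast := shift r (by omega)
  have hlt := (σ ⟨r, by omega⟩).isLt
  ext i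
  have hi := shift i i.isLt
  simp only [Fin.eta] at hi
  rw [Equiv.Perm.one_apply]
  omega
end

section
/- Let r ≥ 1 and n = r + 1. For every v : Fin (r+1) → ℤ there exist a permutation σ of Fin (r+1) with σ ≠ id and an integer c such that v (σ i) − v i ≡ c (mod n) for every i. -/
/-- A map from a finite type to `ZMod n` of the same cardinality `n ≥ 2` is shifted by a constant
under some nontrivial permutation of its domain. -/
theorem exists_perm_ne_one_comp_eq_add {ι : Type*} [Fintype ι] [DecidableEq ι] {n : ℕ} [NeZero n]
    [Nontrivial (ZMod n)] (hn : Fintype.card ι = n) (f : ι → ZMod n) :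
    ∃ σ : Equiv.Perm ι, σ ≠ 1 ∧ ∃ c : ℤ, ∀ i, f (σ i) = f i + c := by
  by_cases hf : Function.Injective f
  · have hb : Function.Bijective f :=
      (Fintype.bijective_iff_injective_and_card f).2 ⟨hf, by rw [hn, ZMod.card]⟩
    let e := Equiv.ofBijective f hb
    have key (i : ι) : f (e.symm (f i + 1)) = f i + 1 := e.apply_symm_apply _
    refine ⟨(e.trans (Equiv.addRight 1)).trans e.symm, fun h => ?_, 1, fun i => ?_⟩
    · obtain ⟨i, -⟩ := hb.2 0
      have hi : e.symm (f i + 1) = i := DFunLike.congr_fun h i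
      have := key i
      rw [hi] at this
      simp at this
    · rw [Int.cast_one]
      exact key i
  · obtain ⟨i, j, hij, hne⟩ := Function.not_injective_iff.1 hf
    refine ⟨Equiv.swap i j, fun h => hne (Equiv.swap_eq_one_iff.1 h), 0, fun k => ?_⟩
    rw [Equiv.swap_apply_def]
    split_ifs with hi hj <;> simp [*]

/-- §4.2: for `n = r + 1` there are no `Y_{Q,n}`-free orbits for `SL_n^{(n)}`. -/
theorem stmt3 (r : ℕ) (hr : 1 ≤ r) (v : Fin (r + 1) → ℤ) :
    ∃ σ : Equiv.Perm (Fin (r + 1)), σ ≠ 1 ∧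
      ∃ c : ℤ, ∀ i, ((r : ℤ) + 1) ∣ v (σ i) - v i - c := by
  have : Fact (1 < r + 1) := ⟨by omega⟩
  obtain ⟨σ, hσ, c, hc⟩ :=
    exists_perm_ne_one_comp_eq_add (Fintype.card_fin (r + 1)) fun i => (v i : ZMod (r + 1))
  refine ⟨σ, hσ, c, fun i => ?_⟩
  have h := (ZMod.intCast_zmod_eq_zero_iff_dvd (v (σ i) - v i - c) (r + 1)).1
    (by push_cast; rw [hc i]; ring)
  exact_mod_cast h
end

section
/- Let r ≥ 1 and n = r + 1, and let v : Fin (r+1) → ℤ satisfy Σ_i v i = r(r+1)/2. Assume that for every permutation σ of Fin (r+1) with σ ≠ id there exists some i with n ∤ (v (σ i) − v i). Then there exists a permutation σ of Fin (r+1) such that n divides v (σ i) − i for every i. -/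
/-- An integer vector indexed by `Fin n` whose residues modulo `n` are not fixed by any nontrivial
permutation of the coordinates has pairwise distinct residues. -/
theorem injective_intCast_zmod_of_perm_free {ι : Type*} {n : ℕ} (v : ι → ℤ)
    (hfree : ∀ σ : Equiv.Perm ι, σ ≠ 1 → ∃ i, ¬ (n : ℤ) ∣ v (σ i) - v i) :
    Function.Injective fun i => (v i : ZMod n) := by
  classical
  intro a b hab
  have hdvd : (n : ℤ) ∣ v b - v a := (ZMod.intCast_eq_intCast_iff_dvd_sub _ _ _).1 hab
  by_contra hne
  obtain ⟨i, hi⟩ := hfree (Equiv.swap a b) (by simpa [Equiv.Perm.one_def] using hne)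
  apply hi
  rcases eq_or_ne i a with rfl | hia
  · simpa using hdvd
  rcases eq_or_ne i b with rfl | hib
  · simpa using (dvd_sub_comm).1 hdvd
  · simp [Equiv.swap_apply_of_ne_of_ne hia hib]

theorem injective_fin_natCast_zmod (n : ℕ) :
    Function.Injective fun i : Fin n => ((i : ℕ) : ZMod n) := by
  intro a b hab
  have h := (ZMod.natCast_eq_natCast_iff' _ _ _).1 hab
  rw [Nat.mod_eq_of_lt a.isLt, Nat.mod_eq_of_lt b.isLt] at h
  exact Fin.ext h


/-- §4.2: every `Y_{Q,n}^{sc}`-free orbit for `SL_n^{(n)}` (with `n = r + 1`)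
meets the staircase vector `(0, 1, …, r)` modulo `Y_{Q,n}^{sc}`. -/
theorem stmt4 (r : ℕ) (hr : 1 ≤ r) (v : Fin (r + 1) → ℤ)
    (hsum : ∑ i, v i = ((r * (r + 1) / 2 : ℕ) : ℤ))
    (hfree : ∀ σ : Equiv.Perm (Fin (r + 1)), σ ≠ 1 →
      ∃ i, ¬ ((r : ℤ) + 1) ∣ v (σ i) - v i) :
    ∃ σ : Equiv.Perm (Fin (r + 1)),
      ∀ i, ((r : ℤ) + 1) ∣ v (σ i) - ((i : ℕ) : ℤ) := by
  have hv : Function.Bijective fun i => (v i : ZMod (r + 1)) :=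
    (Fintype.bijective_iff_injective_and_card _).2
      ⟨injective_intCast_zmod_of_perm_free v (by exact_mod_cast hfree), by simp [ZMod.card]⟩
  have hs : Function.Bijective fun i : Fin (r + 1) => ((i : ℕ) : ZMod (r + 1)) :=
    (Fintype.bijective_iff_injective_and_card _).2
      ⟨injective_fin_natCast_zmod (r + 1), by simp [ZMod.card]⟩
  refine ⟨(Equiv.ofBijective _ hs).trans (Equiv.ofBijective _ hv).symm, fun i => ?_⟩
  have h : (v ((Equiv.ofBijective _ hv).symm (Equiv.ofBijective _ hs i)) : ZMod (r + 1)) =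
      ((i : ℕ) : ZMod (r + 1)) :=
    (Equiv.ofBijective _ hv).apply_symm_apply (Equiv.ofBijective _ hs i)
  have hdvd := (ZMod.intCast_eq_intCast_iff_dvd_sub ((i : ℕ) : ℤ) _ (r + 1)).1
    ((Int.cast_natCast _).trans h.symm)
  exact_mod_cast hdvd
end

section
/- Let r ≥ 1 and n = r + 2. Then: (a) if σ is a permutation of {0,…,r} and there exists an integer c with σ(i) − i ≡ c (mod n) for all i, then σ = id; (b) if v : Fin (r+1) → ℤ satisfies Σ_i v i = r(r+1)/2 and for every permutation σ ≠ id of Fin (r+1) there is no integer c with v (σ i) − v i ≡ c (mod n) for all i, then there exist a permutation σ of Fin (r+1) and an integer c such that v (σ i) − i ≡ c (mod n) for every i. -/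
/-- If two injective maps from `Fin k` to a type with `k + 1` elements both miss the same element,
then they have the same range. -/
theorem exists_eq_of_injective_of_forall_ne {k : ℕ} {α : Type*} [Fintype α] [DecidableEq α]
    (hα : Fintype.card α = k + 1) {f : Fin k → α} (hf : Function.Injective f) {m : α}
    (hm : ∀ j, f j ≠ m) {x : α} (hx : x ≠ m) : ∃ j, f j = x := by
  have hsub : Finset.univ.image f ⊆ Finset.univ.erase m := by
    intro y hy
    obtain ⟨j, -, rfl⟩ := Finset.mem_image.mp hy
    simpa using hm j
  have heq := Finset.eq_of_subset_of_card_le hsub (by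
    rw [Finset.card_erase_of_mem (Finset.mem_univ m), Finset.card_image_of_injective _ hf]
    simp [hα])
  have hmem : x ∈ Finset.univ.image f := by
    rw [heq]
    simpa using hx
  simpa using hmem

/-- A permutation of `{0, …, r}` that is a translation modulo `r + 2` is the identity. -/
theorem perm_eq_one_of_dvd_sub {r : ℕ} (σ : Equiv.Perm (Fin (r + 1))) (c : ℤ)
    (h : ∀ i, ((r : ℤ) + 2) ∣ ((σ i : ℕ) : ℤ) - ((i : ℕ) : ℤ) - c) : σ = 1 := by
  have hsum : ((r : ℤ) + 2) ∣ ∑ i, (((σ i : ℕ) : ℤ) - ((i : ℕ) : ℤ) - c) :=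
    Finset.dvd_sum fun i _ => h i
  rw [Finset.sum_sub_distrib, Finset.sum_sub_distrib,
    Equiv.sum_comp σ (fun i => ((i : ℕ) : ℤ))] at hsum
  have hc : ((r : ℤ) + 2) ∣ c := by
    have hmul : ((r : ℤ) + 2) ∣ -(((r : ℤ) + 1) * c) := by simpa using hsum
    have hadd := dvd_add hmul (dvd_mul_right ((r : ℤ) + 2) c)
    rwa [show -(((r : ℤ) + 1) * c) + ((r : ℤ) + 2) * c = c by ring] at hadd
  ext i
  have hi := dvd_add (h i) hc
  rw [sub_add_cancel] at hi
  have h0 := Int.eq_zero_of_abs_lt_dvd hi (by rw [abs_lt]; omega)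
  simp only [Equiv.Perm.coe_one, id_eq]
  omega

/-- A vector of `r + 1` integers with distinct residues modulo `r + 2` is, up to order, a
translate of `(0, 1, …, r)` modulo `r + 2`. -/
theorem exists_perm_dvd_sub_of_injective {r : ℕ} (v : Fin (r + 1) → ℤ)
    (hv : Function.Injective fun i => (v i : ZMod (r + 2))) :
    ∃ (σ : Equiv.Perm (Fin (r + 1))) (c : ℤ),
      ∀ i, ((r : ℤ) + 2) ∣ v (σ i) - ((i : ℕ) : ℤ) - c := by
  obtain ⟨m, hm⟩ : ∃ m : ZMod (r + 2), ∀ j, (v j : ZMod (r + 2)) ≠ m := by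
    by_contra! hsurj
    have := Fintype.card_le_of_surjective _ hsurj
    simp [ZMod.card] at this
  have hcast (a : ℤ) : (a : ZMod (r + 2)) = 0 ↔ (r : ℤ) + 2 ∣ a := by
    rw [ZMod.intCast_zmod_eq_zero_iff_dvd]
    push_cast
    rfl
  have hne (i : Fin (r + 1)) : (((i : ℕ) : ℤ) : ZMod (r + 2)) + (m + 1) ≠ m := by
    intro h
    have h0 : ((((i : ℕ) : ℤ) + 1 : ℤ) : ZMod (r + 2)) = 0 := by
      push_cast at h ⊢
      linear_combination h
    have := Int.le_of_dvd (by omega) ((hcast _).mp h0)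
    omega
  choose s hs using fun i =>
    exists_eq_of_injective_of_forall_ne (ZMod.card (r + 2)) hv hm (hne i)
  have hinj : Function.Injective s := by
    intro i j hij
    have h := hs i
    rw [hij, hs j] at h
    have h0 : ((((i : ℕ) : ℤ) - ((j : ℕ) : ℤ) : ℤ) : ZMod (r + 2)) = 0 := by
      push_cast at h ⊢
      linear_combination -h
    have := Int.eq_zero_of_abs_lt_dvd ((hcast _).mp h0) (by rw [abs_lt]; omega)
    ext
    omega
  refine ⟨Equiv.ofBijective s (Finite.injective_iff_bijective.mp hinj), (m.val : ℤ) + 1,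
    fun i => ?_⟩
  rw [← hcast]
  have h := hs i
  have hmv : ((m.val : ℕ) : ZMod (r + 2)) = m := ZMod.natCast_zmod_val m
  push_cast at h ⊢
  rw [hmv, Equiv.ofBijective_apply]
  linear_combination h


/-- §4.3: for `n = r + 2` the staircase orbit is `Y_{Q,n}`-free (a), and
every `Y_{Q,n}`-free orbit meets the staircase vector modulo `Y_{Q,n}` (b). -/
theorem stmt6 (r : ℕ) (hr : 1 ≤ r) :
    (∀ σ : Equiv.Perm (Fin (r + 1)),
      (∃ c : ℤ, ∀ i, ((r : ℤ) + 2) ∣ ((σ i : ℕ) : ℤ) - ((i : ℕ) : ℤ) - c) → σ = 1) ∧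
    (∀ v : Fin (r + 1) → ℤ, ∑ i, v i = ((r * (r + 1) / 2 : ℕ) : ℤ) →
      (∀ σ : Equiv.Perm (Fin (r + 1)), σ ≠ 1 →
        ¬ ∃ c : ℤ, ∀ i, ((r : ℤ) + 2) ∣ v (σ i) - v i - c) →
      ∃ (σ : Equiv.Perm (Fin (r + 1))) (c : ℤ),
        ∀ i, ((r : ℤ) + 2) ∣ v (σ i) - ((i : ℕ) : ℤ) - c) := by
  refine ⟨fun σ ⟨c, hc⟩ => perm_eq_one_of_dvd_sub σ c hc, fun v _ hfree =>
    exists_perm_dvd_sub_of_injective v fun a b hab => ?_⟩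
  by_contra hne
  have hdvd : (r : ℤ) + 2 ∣ v b - v a := by
    have := (ZMod.intCast_eq_intCast_iff_dvd_sub _ _ _).mp hab
    push_cast at this
    exact this
  refine hfree (Equiv.swap a b) (fun h => hne (Equiv.swap_eq_one_iff.mp h)) ⟨0, fun i => ?_⟩
  rw [sub_zero]
  rcases eq_or_ne i a with rfl | hia
  · rwa [Equiv.swap_apply_left]
  rcases eq_or_ne i b with rfl | hib
  · rw [Equiv.swap_apply_right, ← neg_sub]
    exact hdvd.neg_right
  · simp [Equiv.swap_apply_of_ne_of_ne hia hib]
end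

section
/- Let r ≥ 2 and set M = 4r + 2. Let t : Fin r → ℤ be defined by t i = 2i + 1, so t = (1, 3, …, 2r−1). Then: (a) for every nontrivial signed permutation (σ, ε) of Fin r there exists some i with M ∤ (ε i · t (σ i) − t i); (b) for every u : Fin r → ℤ with all coordinates odd such that for every nontrivial signed permutation (σ, ε) there exists some i with M ∤ (ε i · u (σ i) − u i), there exists a signed permutation (σ, ε) with M ∣ (ε i · u (σ i) − t i) for all i. -/
/-- An odd integer `x` with `4r + 2 ∤ -x - x` is congruent up to sign to one of
`1, 3, …, 2r - 1` modulo `4r + 2`. -/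
theorem exists_sign_mul_modEq_odd (r : ℕ) (x : ℤ) (hx : Odd x)
    (h : ¬ (4 * (r : ℤ) + 2) ∣ -1 * x - x) :
    ∃ (k : Fin r) (s : ℤ), (s = 1 ∨ s = -1) ∧
      (4 * (r : ℤ) + 2) ∣ s * x - (2 * ((k : ℕ) : ℤ) + 1) := by
  obtain ⟨a, ha⟩ := hx
  have hdiv := Int.emod_add_mul_ediv a (2 * (r : ℤ) + 1)
  have h0 := Int.emod_nonneg a (b := 2 * (r : ℤ) + 1) (by omega)
  have h1 := Int.emod_lt_of_pos a (b := 2 * (r : ℤ) + 1) (by omega)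
  set y := a % (2 * (r : ℤ) + 1)
  set q := a / (2 * (r : ℤ) + 1)
  rcases lt_trichotomy y r with hy | hy | hy
  · refine ⟨⟨y.toNat, by omega⟩, 1, Or.inl rfl, q, ?_⟩
    simp only [Int.toNat_of_nonneg h0]
    linear_combination ha - 2 * hdiv
  · refine absurd ⟨-2 * q - 1, ?_⟩ h
    linear_combination -2 * ha + 4 * hdiv - 4 * hy
  · have h2 : 0 ≤ 2 * (r : ℤ) - y := by omega
    refine ⟨⟨(2 * (r : ℤ) - y).toNat, by omega⟩, -1, Or.inr rfl, -q - 1, ?_⟩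
    simp only [Int.toNat_of_nonneg h2]
    linear_combination -ha + 2 * hdiv


/-- Proposition 5.1 (2nd bullet) / §5.2.5: with `M = 4r + 2`, the orbit of
`t = (1, 3, …, 2r−1)` is free (a) and every free odd-coordinate vector is
equivalent to `t` (b), for signed permutations modulo `M`. -/
theorem stmt7 (r : ℕ) (hr : 2 ≤ r) :
    (∀ (σ : Equiv.Perm (Fin r)) (ε : Fin r → ℤ),
      (∀ i, ε i = 1 ∨ ε i = -1) → ¬ (σ = 1 ∧ ∀ i, ε i = 1) →
      ∃ i : Fin r, ¬ (4 * (r : ℤ) + 2) ∣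
        ε i * (2 * ((σ i : ℕ) : ℤ) + 1) - (2 * ((i : ℕ) : ℤ) + 1)) ∧
    (∀ u : Fin r → ℤ, (∀ i, Odd (u i)) →
      (∀ (σ : Equiv.Perm (Fin r)) (ε : Fin r → ℤ),
        (∀ i, ε i = 1 ∨ ε i = -1) → ¬ (σ = 1 ∧ ∀ i, ε i = 1) →
        ∃ i, ¬ (4 * (r : ℤ) + 2) ∣ ε i * u (σ i) - u i) →
      ∃ (σ : Equiv.Perm (Fin r)) (ε : Fin r → ℤ),
        (∀ i, ε i = 1 ∨ ε i = -1) ∧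
        ∀ i, (4 * (r : ℤ) + 2) ∣ ε i * u (σ i) - (2 * ((i : ℕ) : ℤ) + 1)) := by
  refine ⟨fun σ ε hε hne => ?_, fun u hu hfree => ?_⟩
  · by_contra! hdvd
    have key : ∀ i, σ i = i ∧ ε i = 1 := by
      intro i
      have hd := hdvd i
      have hi := i.isLt
      have hσ := (σ i).isLt
      rcases hε i with h | h
      · rw [h] at hd
        have := Int.eq_zero_of_abs_lt_dvd hd (by rw [abs_lt]; constructor <;> omega)
        exact ⟨Fin.ext (by omega), h⟩
      · rw [h] at hd
        have := Int.eq_zero_of_abs_lt_dvd hd (by rw [abs_lt]; constructor <;> omega)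
        omega
    exact hne ⟨Equiv.ext fun i => (key i).1, fun i => (key i).2⟩
  · have hself : ∀ i, ¬ (4 * (r : ℤ) + 2) ∣ -1 * u i - u i := by
      intro i hi
      obtain ⟨j, hj⟩ := hfree 1 (fun l => if l = i then -1 else 1)
        (fun l => by split_ifs <;> simp) (fun h => by simpa using h.2 i)
      apply hj
      by_cases hji : j = i
      · subst hji
        simpa using hi
      · simp [hji]
    choose f s hs hf using fun i => exists_sign_mul_modEq_odd r (u i) (hu i) (hself i)
    have hinj : Function.Injective f := by
      intro i j hij
      by_contra hne
      have hd : (4 * (r : ℤ) + 2) ∣ s i * u i - s j * u j := by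
        have := dvd_sub (hf i) (hf j)
        rwa [hij, sub_sub_sub_cancel_right] at this
      have hsq : ∀ l, s l * s l = 1 := fun l => by rcases hs l with h | h <;> simp [h]
      obtain ⟨l, hl⟩ := hfree (Equiv.swap i j)
        (fun l => if l = i ∨ l = j then s i * s j else 1)
        (fun l => by
          split_ifs
          · rcases hs i with h | h <;> rcases hs j with h' | h' <;> simp [h, h']
          · simp)
        (fun h => hne (Equiv.swap_eq_one_iff.mp h.1))
      apply hl
      by_cases hli : l = i
      · subst hli
        simp only [true_or, if_true, Equiv.swap_apply_left]
        rw [show s l * s j * u j - u l = -s l * (s l * u l - s j * u j) by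
          linear_combination u l * hsq l]
        exact hd.mul_left _
      by_cases hlj : l = j
      · subst hlj
        simp only [or_true, if_true, Equiv.swap_apply_right]
        rw [show s i * s l * u i - u l = s l * (s i * u i - s l * u l) by
          linear_combination u l * hsq l]
        exact hd.mul_left _
      · simp [hli, hlj, Equiv.swap_apply_of_ne_of_ne]
    let e := Equiv.ofBijective f (Finite.injective_iff_bijective.mp hinj)
    refine ⟨e.symm, fun i => s (e.symm i), fun i => hs _, fun i => ?_⟩
    have := hf (e.symm i)
    rwa [show f (e.symm i) = i from e.apply_symm_apply i] at this
end

section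
/- Let r ≥ 2 and let n be an odd integer with 1 ≤ n ≤ 2r − 1. For every u : Fin r → ℤ with all coordinates odd there exists a nontrivial signed permutation (σ, ε) of Fin r such that 2n divides ε i · u (σ i) − u i for every i. -/
/-- For odd `n`, a signed difference of odd integers divisible by `n` is divisible by `2 * n`. -/
theorem two_mul_dvd_sign_mul_sub {n : ℕ} (hn : Odd n) {s a b : ℤ} (hs : s = 1 ∨ s = -1)
    (ha : Odd a) (hb : Odd b) (h : (n : ℤ) ∣ s * a - b) : 2 * (n : ℤ) ∣ s * a - b := by
  have hcop : IsCoprime (2 : ℤ) n := by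
    rw [Int.isCoprime_iff_gcd_eq_one]
    exact Nat.coprime_two_left.mpr hn
  refine hcop.mul_dvd ?_ h
  rcases hs with rfl | rfl
  · simpa using (ha.sub_odd hb).two_dvd
  · simpa using (ha.neg.sub_odd hb).two_dvd

/-- Integers whose balanced remainders have equal absolute value agree up to sign modulo `n`. -/
theorem exists_sign_dvd_of_natAbs_bmod_eq {n : ℕ} {a b : ℤ}
    (h : (a.bmod n).natAbs = (b.bmod n).natAbs) :
    ∃ s : ℤ, (s = 1 ∨ s = -1) ∧ (n : ℤ) ∣ s * a - b ∧ (n : ℤ) ∣ s * b - a := by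
  have ha := Int.dvd_bmod_sub_self (x := a) (m := n)
  have hb := Int.dvd_bmod_sub_self (x := b) (m := n)
  rcases Int.natAbs_eq_natAbs_iff.mp h with e | e <;> rw [e] at ha
  · have hab : (n : ℤ) ∣ a - b := by simpa using dvd_sub hb ha
    exact ⟨1, Or.inl rfl, by simpa using hab, by simpa using (dvd_sub_comm.mp hab)⟩
  · have hab : (n : ℤ) ∣ -a - b := (dvd_add ha hb).trans (dvd_of_eq (by ring))
    exact ⟨-1, Or.inr rfl, hab.trans (dvd_of_eq (by ring)), hab.trans (dvd_of_eq (by ring))⟩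

/-- If no coordinate is divisible by the odd number `n ≤ 2 * r - 1`, two of the `r` coordinates
have balanced remainders of equal absolute value. -/
theorem exists_ne_natAbs_bmod_eq {r n : ℕ} (hodd : Odd n) (hn : n ≤ 2 * r - 1)
    (u : Fin r → ℤ) (hu : ∀ i, ¬ (n : ℤ) ∣ u i) :
    ∃ i j, i ≠ j ∧ ((u i).bmod n).natAbs = ((u j).bmod n).natAbs := by
  obtain ⟨m, rfl⟩ := hodd
  have hcard : (Finset.Icc 1 m).card < (Finset.univ : Finset (Fin r)).card := by
    simp
    omega
  obtain ⟨i, -, j, -, hij, h⟩ := Finset.exists_ne_map_eq_of_card_lt_of_maps_to hcard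
    (f := fun i => ((u i).bmod (2 * m + 1)).natAbs) (by
      intro i _
      have hne : (u i).bmod (2 * m + 1) ≠ 0 := fun h0 => hu i (Int.dvd_of_bmod_eq_zero h0)
      have hle := Int.bmod_le (x := u i) (m := 2 * m + 1) (by omega)
      have hge := Int.le_bmod (x := u i) (m := 2 * m + 1) (by omega)
      simp only [Finset.coe_Icc, Set.mem_Icc]
      push_cast at hle hge
      omega)
  exact ⟨i, j, hij, h⟩

/-- Proposition 5.1 (3rd bullet): for odd `n ≤ 2r − 1` no orbit of an
odd-coordinate vector is `Y_{Q,n}^{sc}`-free for `Sp_{2r}^{(n)}`. -/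
theorem stmt8 (r n : ℕ) (hr : 2 ≤ r) (hodd : Odd n) (hn1 : 1 ≤ n)
    (hn2 : n ≤ 2 * r - 1)
    (u : Fin r → ℤ) (hu : ∀ i, Odd (u i)) :
    ∃ (σ : Equiv.Perm (Fin r)) (ε : Fin r → ℤ),
      (∀ i, ε i = 1 ∨ ε i = -1) ∧ ¬ (σ = 1 ∧ ∀ i, ε i = 1) ∧
      ∀ i, (2 * (n : ℤ)) ∣ ε i * u (σ i) - u i := by
  by_cases hdvd : ∃ i, (n : ℤ) ∣ u i
  · obtain ⟨i, hi⟩ := hdvd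
    have hsign : ∀ k, (if k = i then -1 else 1 : ℤ) = 1 ∨ (if k = i then -1 else 1 : ℤ) = -1 := by
      intro k
      split_ifs <;> simp
    refine ⟨1, fun k => if k = i then -1 else 1, hsign, fun h => ?_, fun k =>
      two_mul_dvd_sign_mul_sub hodd (hsign k) (hu _) (hu _) ?_⟩
    · simpa using h.2 i
    · by_cases hk : k = i
      · subst hk
        exact dvd_sub (hi.mul_left _) hi
      · simp [hk]
  · obtain ⟨i, j, hij, h⟩ := exists_ne_natAbs_bmod_eq hodd hn2 u (not_exists.mp hdvd)
    obtain ⟨s, hs, h₁, h₂⟩ := exists_sign_dvd_of_natAbs_bmod_eq h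
    have hsign : ∀ k, (if k = i ∨ k = j then s else 1) = 1 ∨
        (if k = i ∨ k = j then s else 1) = -1 := by
      intro k
      split_ifs
      exacts [hs, Or.inl rfl]
    refine ⟨Equiv.swap i j, fun k => if k = i ∨ k = j then s else 1, hsign, fun h => ?_, fun k =>
      two_mul_dvd_sign_mul_sub hodd (hsign k) (hu _) (hu _) ?_⟩
    · exact hij (Equiv.swap_eq_one_iff.mp h.1)
    · by_cases hki : k = i
      · simpa [hki] using h₂
      · by_cases hkj : k = j
        · simpa [hkj] using h₁
        · simp [hki, hkj, Equiv.swap_apply_of_ne_of_ne hki hkj]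
end

section
/- Let r ≥ 2 and let n be an odd integer with n ≥ 2r + 3. Define t, t' : Fin r → ℤ by t i = 2i + 1 for all i, and t' i = 2i + 1 for i ≤ r − 2 with t' (r−1) = 2r + 1 (so t = (1,3,…,2r−1), t' = (1,3,…,2r−3,2r+1)). Then: (a) for every nontrivial signed permutation (σ, ε) of Fin r there exists some i with 2n ∤ (ε i · t (σ i) − t i), and likewise with t' in place of t; (b) there is no signed permutation (σ, ε) with 2n ∣ (ε i · t' (σ i) − t i) for all i. -/
/-- `t = (1, 3, …, 2r−1)` in the doubled 𝐢_C-coordinates. -/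
def tC (r : ℕ) : Fin r → ℤ := fun i => 2 * ((i : ℕ) : ℤ) + 1

/-- `t' = (1, 3, …, 2r−3, 2r+1)` in the doubled 𝐢_C-coordinates. -/
def tC' (r : ℕ) : Fin r → ℤ := fun i =>
  if (i : ℕ) = r - 1 then 2 * (r : ℤ) + 1 else 2 * ((i : ℕ) : ℤ) + 1

/-- If `a` and `b` lie in `(0, n)` and `± a` is congruent to `b` modulo `2 * n`, then the sign is
`+` and `a = b`. -/
theorem sign_eq_one_and_eq_of_two_mul_dvd {n a b e : ℤ} (ha : 0 < a) (han : a < n) (hb : 0 < b)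
    (hbn : b < n) (he : e = 1 ∨ e = -1) (h : 2 * n ∣ e * a - b) : e = 1 ∧ a = b := by
  have h0 : e * a - b = 0 := by
    refine Int.eq_zero_of_abs_lt_dvd h ?_
    rw [abs_lt]
    rcases he with rfl | rfl <;> constructor <;> linarith
  rcases he with rfl | rfl
  · exact ⟨rfl, by linarith⟩
  · linarith

/-- An injective vector with entries in `(0, n)` has trivial stabilizer modulo `2 * n` in the
group of signed permutations. -/
theorem exists_not_two_mul_dvd_of_injective {ι : Type*} {n : ℤ} {t : ι → ℤ}
    (ht : Function.Injective t) (hpos : ∀ i, 0 < t i) (hlt : ∀ i, t i < n)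
    (σ : Equiv.Perm ι) (ε : ι → ℤ) (hε : ∀ i, ε i = 1 ∨ ε i = -1)
    (hne : ¬ (σ = 1 ∧ ∀ i, ε i = 1)) :
    ∃ i, ¬ 2 * n ∣ ε i * t (σ i) - t i := by
  by_contra! h
  have key i := sign_eq_one_and_eq_of_two_mul_dvd (hpos (σ i)) (hlt _) (hpos i) (hlt i) (hε i) (h i)
  exact hne ⟨Equiv.ext fun i => ht (key i).2, fun i => (key i).1⟩

theorem tC_injective (r : ℕ) : Function.Injective (tC r) := fun i j h => by
  simp only [tC] at h
  omega

theorem tC_pos (r : ℕ) (i : Fin r) : 0 < tC r i := by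
  simp only [tC]
  omega

theorem tC_lt (r : ℕ) (i : Fin r) : tC r i < 2 * r := by
  simp only [tC]
  omega

theorem tC'_injective (r : ℕ) : Function.Injective (tC' r) := fun i j h => by
  simp only [tC'] at h
  split_ifs at h <;> omega

theorem tC'_pos (r : ℕ) (i : Fin r) : 0 < tC' r i := by
  simp only [tC']
  split_ifs <;> omega

theorem tC'_lt (r : ℕ) (i : Fin r) : tC' r i < 2 * r + 2 := by
  simp only [tC']
  split_ifs <;> omega

theorem tC'_ne (r : ℕ) (i : Fin r) : tC' r i ≠ 2 * r - 1 := by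
  simp only [tC']
  split_ifs <;> omega


/-- Proposition 5.1 (1st bullet): for odd `n ≥ 2r + 3` the orbits of `t` and
`t'` are `Y_{Q,n}`-free (a) and lie in distinct classes (b). -/
theorem stmt9 (r n : ℕ) (hr : 2 ≤ r) (hodd : Odd n) (hn : 2 * r + 3 ≤ n) :
    ((∀ (σ : Equiv.Perm (Fin r)) (ε : Fin r → ℤ),
        (∀ i, ε i = 1 ∨ ε i = -1) → ¬ (σ = 1 ∧ ∀ i, ε i = 1) →
        ∃ i, ¬ (2 * (n : ℤ)) ∣ ε i * tC r (σ i) - tC r i) ∧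
     (∀ (σ : Equiv.Perm (Fin r)) (ε : Fin r → ℤ),
        (∀ i, ε i = 1 ∨ ε i = -1) → ¬ (σ = 1 ∧ ∀ i, ε i = 1) →
        ∃ i, ¬ (2 * (n : ℤ)) ∣ ε i * tC' r (σ i) - tC' r i)) ∧
    ¬ ∃ (σ : Equiv.Perm (Fin r)) (ε : Fin r → ℤ),
        (∀ i, ε i = 1 ∨ ε i = -1) ∧
        ∀ i, (2 * (n : ℤ)) ∣ ε i * tC' r (σ i) - tC r i := by
  have hlt i : tC r i < n := by have := tC_lt r i; omega
  have hlt' i : tC' r i < n := by have := tC'_lt r i; omega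
  refine ⟨⟨exists_not_two_mul_dvd_of_injective (tC_injective r) (tC_pos r) hlt,
    exists_not_two_mul_dvd_of_injective (tC'_injective r) (tC'_pos r) hlt'⟩, ?_⟩
  rintro ⟨σ, ε, hε, h⟩
  let i : Fin r := ⟨r - 1, by omega⟩
  have hi : tC r i = 2 * r - 1 := by
    simp only [tC, i]
    omega
  refine tC'_ne r (σ i) (hi ▸ ?_)
  exact (sign_eq_one_and_eq_of_two_mul_dvd (tC'_pos r _) (hlt' _) (tC_pos r i) (hlt i)
    (hε i) (h i)).2
end

section
/- Let r ≥ 2, m = 2r and n = 4r. Then: (a) if u : Fin r → ℤ has all coordinates odd and there exists a nontrivial signed permutation (σ, ε) with 2m ∣ (ε i · u (σ i) − u i) for all i, then there exists a nontrivial signed permutation (σ', ε') with 2m ∣ (ε' i · u (σ' i) − u i) for all i and moreover 2n ∣ Σ_i (ε' i · u (σ' i) − u i); (b) if u : Fin r → ℤ has all coordinates odd and for every nontrivial signed permutation (σ, ε) there exists some i with 2m ∤ (ε i · u (σ i) − u i), then there exists a signed permutation (σ, ε) with 2m ∣ (ε i · u (σ i) − (2i+1)) for all i. -/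
/-- If two distinct coordinates of `u` agree up to sign mod `4r`, the corresponding signed
transposition fixes `u` mod `4r`, with total displacement divisible by `8r`. -/
lemma exists_signed_swap {r : ℕ} (u : Fin r → ℤ) {i j : Fin r} (hij : i ≠ j) {s : ℤ}
    (hs : s = 1 ∨ s = -1) (h : (4 * (r : ℤ)) ∣ s * u i - u j) :
    ∃ (σ : Equiv.Perm (Fin r)) (ε : Fin r → ℤ),
      (∀ k, ε k = 1 ∨ ε k = -1) ∧ ¬ (σ = 1 ∧ ∀ k, ε k = 1) ∧
      (∀ k, (4 * (r : ℤ)) ∣ ε k * u (σ k) - u k) ∧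
      (8 * (r : ℤ)) ∣ ∑ k, (ε k * u (σ k) - u k) := by
  obtain ⟨q, hq⟩ := h
  have hi : s * u j - u i = 4 * (r : ℤ) * (-s * q) := by
    rcases hs with rfl | rfl <;> linarith
  set ε : Fin r → ℤ := fun k => if k = i ∨ k = j then s else 1 with hε
  have hval : ∀ k, k ≠ i → k ≠ j → ε k * u (Equiv.swap i j k) - u k = 0 := by
    intro k hki hkj
    simp [hε, hki, hkj, Equiv.swap_apply_of_ne_of_ne hki hkj]
  have hvi : ε i * u (Equiv.swap i j i) - u i = 4 * (r : ℤ) * (-s * q) := by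
    simpa [hε] using hi
  have hvj : ε j * u (Equiv.swap i j j) - u j = 4 * (r : ℤ) * q := by
    simpa [hε] using hq
  refine ⟨Equiv.swap i j, ε, fun k => ?_, fun h => ?_, fun k => ?_, ?_⟩
  · by_cases hk : k = i ∨ k = j
    · simpa [hε, hk] using hs
    · simp [hε, hk]
  · exact hij (Equiv.swap_eq_one_iff.mp h.1)
  · by_cases hki : k = i
    · subst hki
      exact ⟨_, hvi⟩
    · by_cases hkj : k = j
      · subst hkj
        exact ⟨_, hvj⟩
      · rw [hval k hki hkj]
        exact dvd_zero _
  · rw [Fintype.sum_eq_add i j hij fun k hk => hval k hk.1 hk.2, hvi, hvj]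
    rcases hs with rfl | rfl
    · exact ⟨0, by ring⟩
    · exact ⟨q, by ring⟩

/-- An odd integer is not congruent to its negative mod `4r`. -/
lemma not_dvd_neg_sub_of_odd {r : ℕ} {x : ℤ} (hx : Odd x) :
    ¬ (4 * (r : ℤ)) ∣ -1 * x - x := by
  rintro ⟨q, hq⟩
  obtain ⟨a, rfl⟩ := hx
  have : 2 * ((r : ℤ) * q + a) = -1 := by linarith
  omega

/-- Every odd integer is, up to sign, congruent mod `4r` to one of `1, 3, …, 2r - 1`. -/
lemma exists_sign_dvd_sub_of_odd {r : ℕ} (hr : 0 < r) {x : ℤ} (hx : Odd x) :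
    ∃ (c : Fin r) (s : ℤ), (s = 1 ∨ s = -1) ∧
      (4 * (r : ℤ)) ∣ s * x - (2 * ((c : ℕ) : ℤ) + 1) := by
  obtain ⟨a, rfl⟩ := hx
  have hpos : (0 : ℤ) < 2 * r := by omega
  have h0 := Int.emod_nonneg a hpos.ne'
  have h1 := Int.emod_lt_of_pos a hpos
  have h2 := Int.emod_add_mul_ediv a (2 * r)
  set b := a % (2 * r)
  set q := a / (2 * r)
  by_cases hb : b < r
  · refine ⟨⟨b.toNat, by omega⟩, 1, Or.inl rfl, q, ?_⟩
    simp only [Int.toNat_of_nonneg h0]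
    linarith
  · refine ⟨⟨(2 * r - 1 - b).toNat, by omega⟩, -1, Or.inr rfl, -q - 1, ?_⟩
    have h3 : (0 : ℤ) ≤ 2 * r - 1 - b := by omega
    simp only [Int.toNat_of_nonneg h3]
    linarith


/-- §5.2.4 (`m = 2r`, `n = 4r`): (a) any non-free (mod `Y_{Q,n}`) orbit is
already non-free mod `Y_{Q,n}^{sc}`; (b) every `Y_{Q,n}`-free odd-coordinate
vector is equivalent to `(1, 3, …, 2r−1)` mod `Y_{Q,n}`. -/
theorem stmt10 (r : ℕ) (hr : 2 ≤ r) :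
    (∀ u : Fin r → ℤ, (∀ i, Odd (u i)) →
      (∃ (σ : Equiv.Perm (Fin r)) (ε : Fin r → ℤ),
        (∀ i, ε i = 1 ∨ ε i = -1) ∧ ¬ (σ = 1 ∧ ∀ i, ε i = 1) ∧
        ∀ i, (4 * (r : ℤ)) ∣ ε i * u (σ i) - u i) →
      ∃ (σ' : Equiv.Perm (Fin r)) (ε' : Fin r → ℤ),
        (∀ i, ε' i = 1 ∨ ε' i = -1) ∧ ¬ (σ' = 1 ∧ ∀ i, ε' i = 1) ∧
        (∀ i, (4 * (r : ℤ)) ∣ ε' i * u (σ' i) - u i) ∧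
        (8 * (r : ℤ)) ∣ ∑ i, (ε' i * u (σ' i) - u i)) ∧
    (∀ u : Fin r → ℤ, (∀ i, Odd (u i)) →
      (∀ (σ : Equiv.Perm (Fin r)) (ε : Fin r → ℤ),
        (∀ i, ε i = 1 ∨ ε i = -1) → ¬ (σ = 1 ∧ ∀ i, ε i = 1) →
        ∃ i, ¬ (4 * (r : ℤ)) ∣ ε i * u (σ i) - u i) →
      ∃ (σ : Equiv.Perm (Fin r)) (ε : Fin r → ℤ),
        (∀ i, ε i = 1 ∨ ε i = -1) ∧
        ∀ i, (4 * (r : ℤ)) ∣ ε i * u (σ i) - (2 * ((i : ℕ) : ℤ) + 1)) := by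
  refine ⟨?_, ?_⟩
  · rintro u hu ⟨σ, ε, hε, hne, hd⟩
    have hσ : σ ≠ 1 := by
      rintro rfl
      refine hne ⟨rfl, fun i => (hε i).resolve_right fun h => ?_⟩
      have := hd i
      rw [h] at this
      exact not_dvd_neg_sub_of_odd (hu i) this
    obtain ⟨i, hi⟩ : ∃ i, σ i ≠ i := by
      by_contra! h
      exact hσ (Equiv.ext h)
    exact exists_signed_swap u hi (hε i) (hd i)
  · intro u hu hfree
    choose f s hs hf using fun i => exists_sign_dvd_sub_of_odd (by omega : 0 < r) (hu i)
    have hinj : Function.Injective f := by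
      intro i j hij
      by_contra hne
      have hdiff : (4 * (r : ℤ)) ∣ s j * s i * u i - u j := by
        have hi := hf i
        rw [hij] at hi
        have h := (dvd_sub hi (hf j)).mul_left (s j)
        have hsq : s j * s j = 1 := by rcases hs j with h | h <;> simp [h]
        have heq : s j * s i * u i - u j = s j * (s i * u i - (2 * ((f j : ℕ) : ℤ) + 1) -
            (s j * u j - (2 * ((f j : ℕ) : ℤ) + 1))) := by
          linear_combination u j * hsq
        rwa [heq]
      have hsign : s j * s i = 1 ∨ s j * s i = -1 := by
        rcases hs i with h | h <;> rcases hs j with h' | h' <;> simp [h, h']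
      obtain ⟨σ, ε, hε, hnt, hd, -⟩ := exists_signed_swap u hne hsign hdiff
      obtain ⟨k, hk⟩ := hfree σ ε hε hnt
      exact hk (hd k)
    let e := Equiv.ofBijective f (Finite.injective_iff_bijective.mp hinj)
    refine ⟨e.symm, fun i => s (e.symm i), fun i => hs _, fun i => ?_⟩
    have h := hf (e.symm i)
    rwa [show f (e.symm i) = i from e.apply_symm_apply i] at h
end

section
/- Let r ≥ 2, m = 2r + 1 and n = 4r + 2. Define r + 1 vectors u₀, u₁, …, u_r : Fin r → ℤ as follows: u₀ = (1, 3, 5, …, 2r−1); for 1 ≤ k ≤ r − 1, u_k has first coordinate −1 and remaining coordinates the odd numbers 3, 5, …, 2r+1 listed in increasing order with 2k+1 omitted; and u_r = (3, 5, …, 2r+1). Then: (a) for each k ∈ {0,…,r} and every nontrivial signed permutation (σ, ε) of Fin r, it is not the case that both 2m ∣ (ε i · u_k (σ i) − u_k i) for all i and 2n ∣ Σ_i (ε i · u_k (σ i) − u_k i); (b) for k ≠ l in {0,…,r} there is no signed permutation (σ, ε) with 2m ∣ (ε i · u_l (σ i) − u_k i) for all i; (c) for each 1 ≤ k ≤ r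 there exists a nontrivial signed permutation (σ, ε) with 2m ∣ (ε i · u_k (σ i) − u_k i) for all i. -/
/-- The vectors `u₀, …, u_r` of §5.2.5 in the doubled 𝐢_C-coordinates:
`u₀ = (1, 3, …, 2r−1)`; for `1 ≤ k ≤ r−1`, `u_k` has first coordinate `−1`
followed by `3, 5, …, 2r+1` in increasing order with `2k+1` omitted;
`u_r = (3, 5, …, 2r+1)`. -/
def uC (r k : ℕ) : Fin r → ℤ := fun i =>
  if k = 0 then 2 * ((i : ℕ) : ℤ) + 1
  else if k = r then 2 * ((i : ℕ) : ℤ) + 3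
  else if (i : ℕ) = 0 then -1
  else if (i : ℕ) < k then 2 * ((i : ℕ) : ℤ) + 1
  else 2 * ((i : ℕ) : ℤ) + 3

theorem abs_uC_le {r k : ℕ} (i : Fin r) : |uC r k i| ≤ 2 * (r : ℤ) + 1 := by
  have := i.isLt
  rw [abs_le]
  unfold uC
  split_ifs <;> omega

theorem abs_uC_injective {r k : ℕ} : Function.Injective fun i => |uC r k i| := by
  intro i j h
  have h' := abs_eq_abs.mp h
  apply Fin.ext
  unfold uC at h'
  split_ifs at h' <;> omega

/-- If `a ≡ ± b` modulo `2 M` and both lie in `[-M, M]`, then `|a| = |b|`. -/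
theorem abs_eq_abs_of_dvd_sign_mul_sub {M a b e : ℤ} (ha : |a| ≤ M) (hb : |b| ≤ M)
    (he : e = 1 ∨ e = -1) (h : 2 * M ∣ e * a - b) : |a| = |b| := by
  rw [abs_le] at ha hb
  rw [abs_eq_abs]
  by_cases h0 : e * a - b = 0
  · rcases he with rfl | rfl <;> omega
  · have := Int.le_of_dvd (abs_pos.mpr h0) ((dvd_abs _ _).mpr h)
    rcases he with rfl | rfl <;> rcases le_abs.mp this with h | h <;> omega

theorem abs_uC_eq_of_dvd {r k l : ℕ} {i j : Fin r} {e : ℤ}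
    (he : e = 1 ∨ e = -1) (h : 2 * (2 * (r : ℤ) + 1) ∣ e * uC r l j - uC r k i) :
    |uC r l j| = |uC r k i| :=
  abs_eq_abs_of_dvd_sign_mul_sub (abs_uC_le j) (abs_uC_le i) he h

/-- For `k ≠ l` some absolute value of an entry of `uC r l` is missing from `uC r k`. -/
theorem exists_abs_uC_ne {r k l : ℕ} (hk : k ≤ r) (hl : l ≤ r) (hkl : k ≠ l) :
    ∃ j : Fin r, ∀ i : Fin r, |uC r l j| ≠ |uC r k i| := by
  obtain ⟨j, hj, hu⟩ : ∃ j, ∃ hj : j < r, |uC r l ⟨j, hj⟩| =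
      if k = 0 then 2 * (r : ℤ) + 1 else if k = r then 1 else 2 * (k : ℤ) + 1 := by
    refine ⟨if k = 0 then r - 1 else if k = r then 0 else if l = 0 ∨ k < l ∧ l < r then k
      else k - 1, by split_ifs <;> omega, ?_⟩
    rw [abs_eq (by split_ifs <;> omega)]
    unfold uC
    dsimp only
    split_ifs <;> omega
  refine ⟨⟨j, hj⟩, fun i h => ?_⟩
  rw [hu, eq_comm, abs_eq (by split_ifs <;> omega)] at h
  have := i.isLt
  unfold uC at h
  split_ifs at h <;> omega

theorem uC_last {r k : ℕ} (hr : 2 ≤ r) (hk : 1 ≤ k) (hkr : k ≤ r) :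
    uC r k ⟨r - 1, by omega⟩ = 2 * (r : ℤ) + 1 := by
  unfold uC
  dsimp only
  split_ifs <;> omega

/-- §5.2.5 (`m = 2r + 1`, `n = 4r + 2`): (a) each orbit of `u_k` is
`Y_{Q,n}^{sc}`-free; (b) the `u_k` are pairwise inequivalent mod `Y_{Q,n}`;
(c) for `1 ≤ k ≤ r` the orbit of `u_k` is not `Y_{Q,n}`-free. -/
theorem stmt11 (r : ℕ) (hr : 2 ≤ r) :
    (∀ k ≤ r, ∀ (σ : Equiv.Perm (Fin r)) (ε : Fin r → ℤ),
      (∀ i, ε i = 1 ∨ ε i = -1) → ¬ (σ = 1 ∧ ∀ i, ε i = 1) →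
      ¬ ((∀ i, (2 * (2 * (r : ℤ) + 1)) ∣ ε i * uC r k (σ i) - uC r k i) ∧
         (2 * (4 * (r : ℤ) + 2)) ∣ ∑ i, (ε i * uC r k (σ i) - uC r k i))) ∧
    (∀ k ≤ r, ∀ l ≤ r, k ≠ l →
      ¬ ∃ (σ : Equiv.Perm (Fin r)) (ε : Fin r → ℤ),
        (∀ i, ε i = 1 ∨ ε i = -1) ∧
        ∀ i, (2 * (2 * (r : ℤ) + 1)) ∣ ε i * uC r l (σ i) - uC r k i) ∧
    (∀ k, 1 ≤ k → k ≤ r →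
      ∃ (σ : Equiv.Perm (Fin r)) (ε : Fin r → ℤ),
        (∀ i, ε i = 1 ∨ ε i = -1) ∧ ¬ (σ = 1 ∧ ∀ i, ε i = 1) ∧
        ∀ i, (2 * (2 * (r : ℤ) + 1)) ∣ ε i * uC r k (σ i) - uC r k i) := by
  refine ⟨?_, ?_, ?_⟩
  · rintro k hk σ ε hε hne ⟨hd, hs⟩
    have hσ : σ = 1 := by
      ext1 i
      exact abs_uC_injective (abs_uC_eq_of_dvd (hε i) (hd i))
    subst hσ
    simp only [Equiv.Perm.one_apply, true_and, not_forall] at hne hd hs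
    obtain ⟨i, hi⟩ := hne
    have key : ∀ j, ε j ≠ 1 → |uC r k j| = 2 * (r : ℤ) + 1 ∧ ε j = -1 := by
      intro j hj
      have hj' := (hε j).resolve_left hj
      refine ⟨le_antisymm (abs_uC_le j) ?_, hj'⟩
      have h0 : uC r k j ≠ 0 := by unfold uC; split_ifs <;> omega
      have h := hd j
      rw [hj', show -1 * uC r k j - uC r k j = 2 * -uC r k j by ring] at h
      have h := (dvd_abs _ _).mpr (dvd_neg.mp (Int.dvd_of_mul_dvd_mul_left (by norm_num) h))
      exact Int.le_of_dvd (abs_pos.mpr h0) h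
    rw [Finset.sum_eq_single i] at hs
    · obtain ⟨hu, he⟩ := key i hi
      rw [he] at hs
      rcases (abs_eq (by omega)).mp hu with hu | hu <;> rw [hu] at hs
      · have := Int.le_of_dvd (by omega) ((dvd_neg).mpr hs)
        omega
      · have := Int.le_of_dvd (by omega) hs
        omega
    · intro j _ hji
      by_cases hj : ε j = 1
      · simp [hj]
      · exact absurd (abs_uC_injective ((key j hj).1.trans (key i hi).1.symm)) hji
    · simp
  · rintro k hk l hl hkl ⟨σ, ε, hε, hd⟩
    obtain ⟨j, hj⟩ := exists_abs_uC_ne hk hl hkl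
    apply hj (σ.symm j)
    simpa using abs_uC_eq_of_dvd (hε (σ.symm j)) (hd (σ.symm j))
  · intro k hk hkr
    refine ⟨1, fun i => if i = ⟨r - 1, by omega⟩ then -1 else 1, ?_, ?_, ?_⟩
    · intro i
      dsimp only
      split_ifs <;> simp
    · rintro ⟨-, h⟩
      simpa using h ⟨r - 1, by omega⟩
    · intro i
      dsimp only [Equiv.Perm.one_apply]
      split_ifs with h
      · rw [h, uC_last hr hk hkr]
        exact ⟨-1, by ring⟩
      · simp
end

section
/- Let r ≥ 2 and let n be an odd integer with 1 ≤ n ≤ 2r − 1. For every v : Fin r → ℤ such that Σ_i v i + r(r+1)/2 is even, there exists a nontrivial signed permutation (σ, ε) of Fin r such that n divides ε i · v (σ i) − v i for every i. -/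
/-- Among `r` integers with `n < 2 * r`, `n` odd, either one is divisible by `n`, or two of them
agree modulo `n` up to sign. -/
theorem exists_dvd_or_exists_dvd_sub_or_add {r n : ℕ} (hodd : Odd n) (hn : n < 2 * r)
    (v : Fin r → ℤ) :
    (∃ i, (n : ℤ) ∣ v i) ∨
      ∃ i j, i ≠ j ∧ ((n : ℤ) ∣ v i - v j ∨ (n : ℤ) ∣ v i + v j) := by
  have : NeZero n := ⟨hodd.pos.ne'⟩
  by_cases h0 : ∃ i, (n : ℤ) ∣ v i
  · exact Or.inl h0
  push Not at h0
  right
  have hmaps : ∀ i ∈ (Finset.univ : Finset (Fin r)),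
      ((v i : ZMod n).valMinAbs.natAbs) ∈ Finset.Icc 1 (n / 2) := by
    intro i _
    refine Finset.mem_Icc.2 ⟨?_, ZMod.natAbs_valMinAbs_le _⟩
    rw [Nat.one_le_iff_ne_zero, Int.natAbs_ne_zero, Ne, ZMod.valMinAbs_eq_zero,
      ZMod.intCast_zmod_eq_zero_iff_dvd]
    exact h0 i
  have hcard : (Finset.Icc 1 (n / 2)).card < (Finset.univ : Finset (Fin r)).card := by
    simp only [Nat.card_Icc, Finset.card_univ, Fintype.card_fin]
    obtain ⟨k, rfl⟩ := hodd
    omega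
  obtain ⟨i, -, j, -, hij, h⟩ := Finset.exists_ne_map_eq_of_card_lt_of_maps_to hcard hmaps
  refine ⟨i, j, hij, ?_⟩
  rcases Int.natAbs_eq_natAbs_iff.1 h with h | h
  · left
    have h' := congrArg (Int.cast : ℤ → ZMod n) h
    simp only [ZMod.coe_valMinAbs] at h'
    rw [← ZMod.intCast_zmod_eq_zero_iff_dvd, Int.cast_sub, h', sub_self]
  · right
    have h' := congrArg (Int.cast : ℤ → ZMod n) h
    simp only [Int.cast_neg, ZMod.coe_valMinAbs] at h'
    rw [← ZMod.intCast_zmod_eq_zero_iff_dvd, Int.cast_add, h', neg_add_cancel]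

/-- If `n` divides `s * v j - v i` with `s = ± 1`, the signed transposition of `i` and
`j` with sign `s` fixes `v` modulo `n`. -/
theorem dvd_signed_swap_sub {ι : Type*} [DecidableEq ι] {n s : ℤ} (hs : s = 1 ∨ s = -1)
    (v : ι → ℤ) {i j : ι} (h : n ∣ s * v j - v i) (k : ι) :
    n ∣ (if k = i ∨ k = j then s else 1) * v (Equiv.swap i j k) - v k := by
  by_cases hi : k = i
  · subst hi
    simpa using h
  by_cases hj : k = j
  · subst hj
    rw [if_pos (Or.inr rfl), Equiv.swap_apply_right]
    rcases hs with rfl | rfl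
    · rw [one_mul] at h ⊢
      exact dvd_sub_comm.1 h
    · convert h using 1
      ring
  · simp [hi, hj, Equiv.swap_apply_of_ne_of_ne hi hj]

/-- Proposition 6.1 (2nd case): for odd `n ≤ 2r − 1` there are no
`Y_{Q,n}^{sc}`-free orbits for `Spin_{2r+1}^{(n)}`. -/
theorem stmt12 (r n : ℕ) (hr : 2 ≤ r) (hodd : Odd n) (hn1 : 1 ≤ n)
    (hn2 : n ≤ 2 * r - 1)
    (v : Fin r → ℤ) (hv : Even (∑ i, v i + ((r * (r + 1) / 2 : ℕ) : ℤ))) :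
    ∃ (σ : Equiv.Perm (Fin r)) (ε : Fin r → ℤ),
      (∀ i, ε i = 1 ∨ ε i = -1) ∧ ¬ (σ = 1 ∧ ∀ i, ε i = 1) ∧
      ∀ i, (n : ℤ) ∣ ε i * v (σ i) - v i := by
  rcases exists_dvd_or_exists_dvd_sub_or_add hodd (by omega : n < 2 * r) v with
    ⟨i, hi⟩ | ⟨i, j, hij, h⟩
  · refine ⟨1, fun k => if k = i then -1 else 1, fun k => ?_, fun h => ?_, fun k => ?_⟩
    · dsimp only
      split_ifs <;> simp
    · simpa using h.2 i
    · by_cases hk : k = i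
      · subst hk
        simpa using dvd_sub (dvd_neg.2 hi) hi
      · simp [hk]
  · obtain ⟨s, hs, hd⟩ : ∃ s : ℤ, (s = 1 ∨ s = -1) ∧ (n : ℤ) ∣ s * v j - v i := by
      rcases h with h | h
      · exact ⟨1, Or.inl rfl, by rw [one_mul]; exact dvd_sub_comm.1 h⟩
      · refine ⟨-1, Or.inr rfl, ?_⟩
        rw [show -1 * v j - v i = -(v i + v j) by ring]
        exact dvd_neg.2 h
    refine ⟨Equiv.swap i j, fun k => if k = i ∨ k = j then s else 1, fun k => ?_, fun h => ?_,
      dvd_signed_swap_sub hs v hd⟩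
    · dsimp only
      split_ifs
      · exact hs
      · exact Or.inl rfl
    · exact hij (Equiv.swap_eq_one_iff.1 h.1)
end

section
/- Let r ≥ 2, n = 2r + 1, and let v* : Fin r → ℤ be given by v* i = i + 1, so v* = (1, 2, …, r). Then: (a) for every nontrivial signed permutation (σ, ε) of Fin r there exists some i with n ∤ (ε i · v* (σ i) − v* i); (b) for every v : Fin r → ℤ with Σ_i v i + r(r+1)/2 even such that for every nontrivial signed permutation (σ, ε) there exists some i with n ∤ (ε i · v (σ i) − v i), there exists a signed permutation (σ, ε) with n ∣ (ε i · v (σ i) − (i+1)) for all i. -/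
/-- An integer not divisible by `2 * r + 1` is, up to sign, congruent to exactly one of
`1, …, r`; this gives existence. -/
theorem exists_sign_mul_modEq_succ {r : ℕ} {x : ℤ} (hx : ¬ (2 * (r : ℤ) + 1) ∣ x) :
    ∃ (k : Fin r) (s : ℤ), (s = 1 ∨ s = -1) ∧
      (2 * (r : ℤ) + 1) ∣ s * x - (((k : ℕ) : ℤ) + 1) := by
  have hn : 0 < 2 * (r : ℤ) + 1 := by positivity
  have h0 : 0 ≤ x % (2 * (r : ℤ) + 1) := Int.emod_nonneg _ hn.ne'
  have h1 : x % (2 * (r : ℤ) + 1) < 2 * (r : ℤ) + 1 := Int.emod_lt_of_pos _ hn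
  have h2 : x % (2 * (r : ℤ) + 1) ≠ 0 := fun h => hx (Int.dvd_of_emod_eq_zero h)
  have h3 := Int.emod_add_mul_ediv x (2 * (r : ℤ) + 1)
  generalize x % (2 * (r : ℤ) + 1) = m at *
  generalize x / (2 * (r : ℤ) + 1) = q at *
  by_cases hm : m ≤ r
  · refine ⟨⟨(m - 1).toNat, by omega⟩, 1, Or.inl rfl, q, ?_⟩
    have : (((m - 1).toNat : ℕ) : ℤ) = m - 1 := Int.toNat_of_nonneg (by omega)
    simp only [this]
    linarith
  · refine ⟨⟨(2 * (r : ℤ) - m).toNat, by omega⟩, -1, Or.inr rfl, -q - 1, ?_⟩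
    have : (((2 * (r : ℤ) - m).toNat : ℕ) : ℤ) = 2 * (r : ℤ) - m :=
      Int.toNat_of_nonneg (by omega)
    simp only [this]
    linarith

/-- The sign and the representative in `1, …, r` of a class modulo `2 * r + 1` are unique. -/
theorem eq_one_and_eq_of_dvd_sign_mul_sub {r : ℕ} {a b : Fin r} {s : ℤ} (hs : s = 1 ∨ s = -1)
    (h : (2 * (r : ℤ) + 1) ∣ s * (((a : ℕ) : ℤ) + 1) - (((b : ℕ) : ℤ) + 1)) :
    s = 1 ∧ a = b := by
  have ha := a.isLt
  have hb := b.isLt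
  have h0 := Int.eq_zero_of_abs_lt_dvd h (by rcases hs with rfl | rfl <;> rw [abs_lt] <;> omega)
  rcases hs with rfl | rfl
  · exact ⟨rfl, Fin.ext (by omega)⟩
  · omega

/-- Proposition 6.1 (3rd case), `n = 2r + 1`: (a) the orbit of
`v* = (1, 2, …, r)` is free; (b) every free orbit is equivalent to that
of `v*`. -/
theorem stmt13 (r : ℕ) (hr : 2 ≤ r) :
    (∀ (σ : Equiv.Perm (Fin r)) (ε : Fin r → ℤ),
      (∀ i, ε i = 1 ∨ ε i = -1) → ¬ (σ = 1 ∧ ∀ i, ε i = 1) →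
      ∃ i : Fin r, ¬ (2 * (r : ℤ) + 1) ∣
        ε i * (((σ i : ℕ) : ℤ) + 1) - (((i : ℕ) : ℤ) + 1)) ∧
    (∀ v : Fin r → ℤ, Even (∑ i, v i + ((r * (r + 1) / 2 : ℕ) : ℤ)) →
      (∀ (σ : Equiv.Perm (Fin r)) (ε : Fin r → ℤ),
        (∀ i, ε i = 1 ∨ ε i = -1) → ¬ (σ = 1 ∧ ∀ i, ε i = 1) →
        ∃ i, ¬ (2 * (r : ℤ) + 1) ∣ ε i * v (σ i) - v i) →
      ∃ (σ : Equiv.Perm (Fin r)) (ε : Fin r → ℤ),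
        (∀ i, ε i = 1 ∨ ε i = -1) ∧
        ∀ i, (2 * (r : ℤ) + 1) ∣ ε i * v (σ i) - (((i : ℕ) : ℤ) + 1)) := by
  refine ⟨fun σ ε hε hne => ?_, fun v _ hv => ?_⟩
  · by_contra! h
    have key := fun i => eq_one_and_eq_of_dvd_sign_mul_sub (hε i) (h i)
    exact hne ⟨Equiv.ext fun i => (key i).2, fun i => (key i).1⟩
  · have hnz : ∀ i, ¬ (2 * (r : ℤ) + 1) ∣ v i := by
      intro i hi
      obtain ⟨j, hj⟩ := hv 1 (fun j => if j = i then -1 else 1)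
        (fun j => by split_ifs <;> simp)
        (fun h => by simpa using h.2 i)
      apply hj
      by_cases hji : j = i
      · subst hji
        simpa using (hi.mul_left (-1)).sub hi
      · simp [hji]
    choose f s hs hf using fun i => exists_sign_mul_modEq_succ (hnz i)
    have hinj : Function.Injective f := by
      intro i j hij
      by_contra hne
      have hd : (2 * (r : ℤ) + 1) ∣ s i * v i - s j * v j := by
        have hi := hf i
        rw [hij] at hi
        simpa using hi.sub (hf j)
      have hsq : ∀ k, s k * s k = 1 := fun k => by rcases hs k with h | h <;> simp [h]
      obtain ⟨k, hk⟩ := hv (Equiv.swap i j) (fun k => if k = i ∨ k = j then s i * s j else 1)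
        (fun k => by
          split_ifs
          · rcases hs i with h | h <;> rcases hs j with h' | h' <;> simp [h, h']
          · simp)
        (fun h => hne (Equiv.swap_eq_one_iff.mp h.1))
      apply hk
      by_cases hki : k = i
      · subst hki
        simp only [true_or, if_true, Equiv.swap_apply_left]
        obtain ⟨c, hc⟩ := hd
        exact ⟨-s k * c, by linear_combination -s k * hc + v k * hsq k⟩
      · by_cases hkj : k = j
        · subst hkj
          simp only [or_true, if_true, Equiv.swap_apply_right]
          obtain ⟨c, hc⟩ := hd
          exact ⟨s k * c, by linear_combination s k * hc + v k * hsq k⟩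
        · simp [hki, hkj, Equiv.swap_apply_of_ne_of_ne hki hkj]
    let e : Equiv.Perm (Fin r) := Equiv.ofBijective f (Finite.injective_iff_bijective.mp hinj)
    refine ⟨e.symm, fun i => s (e.symm i), fun i => hs _, fun i => ?_⟩
    have h := hf (e.symm i)
    rwa [show f (e.symm i) = i from e.apply_symm_apply i] at h
end

section
/- Let r ≥ 3 and let n be an odd integer with n ≥ 2r + 3. Let v* = (1, 2, …, r) (i.e., v* i = i + 1) and let v' = (1, 2, …, r−2, r, r+1) (i.e., v' i = i + 1 for i ≤ r − 3, v' (r−2) = r, v' (r−1) = r + 1). Then: (a) for every nontrivial signed permutation (σ, ε) of Fin r there exists some i with n ∤ (ε i · v* (σ i) − v* i), and likewise with v' in place of v*; (b) there is no signed permutation (σ, ε) with n ∣ (ε i · v' (σ i) − v* i) for all i. -/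
/-- `v* = (1, 2, …, r)` in the 𝐢_B-coordinates. -/
def vB (r : ℕ) : Fin r → ℤ := fun i => ((i : ℕ) : ℤ) + 1

/-- `v' = (1, 2, …, r−2, r, r+1)` in the 𝐢_B-coordinates. -/
def vB' (r : ℕ) : Fin r → ℤ := fun i =>
  if (i : ℕ) = r - 1 then (r : ℤ) + 1
  else if (i : ℕ) = r - 2 then (r : ℤ)
  else ((i : ℕ) : ℤ) + 1

theorem eq_of_dvd_sign_mul_sub {n m a b e : ℤ} (hn : 2 * m < n) (ha : 1 ≤ a) (ham : a ≤ m)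
    (hb : 1 ≤ b) (hbm : b ≤ m) (he : e = 1 ∨ e = -1) (h : n ∣ e * a - b) :
    e = 1 ∧ a = b := by
  have h0 : e * a - b = 0 := by
    refine Int.eq_zero_of_abs_lt_dvd h ?_
    rw [abs_lt]
    rcases he with rfl | rfl <;> constructor <;> linarith
  rcases he with rfl | rfl
  · exact ⟨rfl, by linarith⟩
  · linarith

/-- An injective vector with entries in `[1, m]` has a free orbit modulo `n > 2 * m`
under signed permutations. -/
theorem exists_not_dvd_of_injective {ι : Type*} {n m : ℤ} (hn : 2 * m < n) {v : ι → ℤ}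
    (hv : Function.Injective v) (h1 : ∀ i, 1 ≤ v i) (hm : ∀ i, v i ≤ m)
    (σ : Equiv.Perm ι) (ε : ι → ℤ) (hε : ∀ i, ε i = 1 ∨ ε i = -1)
    (hne : ¬ (σ = 1 ∧ ∀ i, ε i = 1)) : ∃ i, ¬ n ∣ ε i * v (σ i) - v i := by
  by_contra! h
  have key i := eq_of_dvd_sign_mul_sub hn (h1 (σ i)) (hm (σ i)) (h1 i) (hm i) (hε i) (h i)
  exact hne ⟨Equiv.ext fun i => hv (key i).2, fun i => (key i).1⟩

theorem vB_injective (r : ℕ) : Function.Injective (vB r) := by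
  intro i j h
  simp only [vB] at h
  omega

theorem one_le_vB (r : ℕ) (i : Fin r) : 1 ≤ vB r i := by
  simp only [vB]
  omega

theorem vB_le (r : ℕ) (i : Fin r) : vB r i ≤ r := by
  simp only [vB]
  omega

theorem vB'_injective (r : ℕ) : Function.Injective (vB' r) := by
  intro i j h
  simp only [vB'] at h
  split_ifs at h <;> omega

theorem one_le_vB' (r : ℕ) (i : Fin r) : 1 ≤ vB' r i := by
  simp only [vB']
  split_ifs <;> omega

theorem vB'_le (r : ℕ) (i : Fin r) : vB' r i ≤ r + 1 := by
  simp only [vB']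
  split_ifs <;> omega

/-- Proposition 6.1 (1st case): for odd `n ≥ 2r + 3` the orbits of `v*` and
`v'` are free (a) and lie in distinct classes (b). -/
theorem stmt14 (r n : ℕ) (hr : 3 ≤ r) (hodd : Odd n) (hn : 2 * r + 3 ≤ n) :
    ((∀ (σ : Equiv.Perm (Fin r)) (ε : Fin r → ℤ),
        (∀ i, ε i = 1 ∨ ε i = -1) → ¬ (σ = 1 ∧ ∀ i, ε i = 1) →
        ∃ i, ¬ (n : ℤ) ∣ ε i * vB r (σ i) - vB r i) ∧
     (∀ (σ : Equiv.Perm (Fin r)) (ε : Fin r → ℤ),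
        (∀ i, ε i = 1 ∨ ε i = -1) → ¬ (σ = 1 ∧ ∀ i, ε i = 1) →
        ∃ i, ¬ (n : ℤ) ∣ ε i * vB' r (σ i) - vB' r i)) ∧
    ¬ ∃ (σ : Equiv.Perm (Fin r)) (ε : Fin r → ℤ),
        (∀ i, ε i = 1 ∨ ε i = -1) ∧
        ∀ i, (n : ℤ) ∣ ε i * vB' r (σ i) - vB r i := by
  have hn' : 2 * ((r : ℤ) + 1) < n := by omega
  have hle (i : Fin r) : vB r i ≤ r + 1 := (vB_le r i).trans (by omega)
  refine ⟨⟨exists_not_dvd_of_injective hn' (vB_injective r) (one_le_vB r) hle,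
    exists_not_dvd_of_injective hn' (vB'_injective r) (one_le_vB' r) (vB'_le r)⟩, ?_⟩
  rintro ⟨σ, ε, hε, h⟩
  let l : Fin r := ⟨r - 1, by omega⟩
  have hl : vB' r l = r + 1 := by simp [vB', l]
  have key := (eq_of_dvd_sign_mul_sub hn' (one_le_vB' r _) (vB'_le r _) (one_le_vB r _) (hle _)
    (hε (σ.symm l)) (h (σ.symm l))).2
  rw [Equiv.apply_symm_apply, hl] at key
  have := vB_le r (σ.symm l)
  omega
end

section
/- Let r ≥ 2, let m be an integer with 1 ≤ m ≤ r, and set n = 2m. For every v : Fin r → ℤ such that Σ_i v i + r(r+1)/2 is even, there exists a nontrivial signed permutation (σ, ε) of Fin r such that 2m divides ε i · v (σ i) − v i for every i. -/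
/-- Among at least `m` integers, either one is divisible by `m`, or two of them agree up to sign
modulo `2 * m`. -/
theorem exists_dvd_or_exists_ne_dvd_sub_or_dvd_add {ι : Type*} [Fintype ι] {m : ℕ}
    (hm1 : 1 ≤ m) (hm2 : m ≤ Fintype.card ι) (v : ι → ℤ) :
    (∃ i, (m : ℤ) ∣ v i) ∨
      ∃ i j, i ≠ j ∧ ((2 * (m : ℤ)) ∣ v j - v i ∨ (2 * (m : ℤ)) ∣ v j + v i) := by
  by_contra! ⟨h0, hne⟩
  have hcard : (Finset.Icc (1 : ℤ) (m - 1)).card < (Finset.univ : Finset ι).card := by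
    simp only [Int.card_Icc, Finset.card_univ]
    lia
  obtain ⟨i, -, j, -, hij, hf⟩ := Finset.exists_ne_map_eq_of_card_lt_of_maps_to hcard
    (f := fun i => min (v i % (2 * m)) (2 * m - v i % (2 * m))) (by
      intro i _
      have hlt := Int.emod_lt_of_pos (v i) (show (0 : ℤ) < 2 * m by lia)
      have hnn := Int.emod_nonneg (v i) (show (2 * m : ℤ) ≠ 0 by lia)
      have hdvd : (m : ℤ) ∣ v i - v i % (2 * m) :=
        (Dvd.intro_left 2 rfl).trans (Int.dvd_self_sub_emod)
      have hne0 : v i % (2 * m) ≠ 0 := fun h => h0 i (by simpa [h] using hdvd)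
      have hnem : v i % (2 * m) ≠ m := fun h => h0 i (by simpa [h] using hdvd)
      simp only [Finset.coe_Icc, Set.mem_Icc]
      lia)
  obtain ⟨h1, h2⟩ := hne i j hij
  have ei := Int.emod_add_mul_ediv (v i) (2 * m)
  have ej := Int.emod_add_mul_ediv (v j) (2 * m)
  have hcases : v j % (2 * m) = v i % (2 * m) ∨ v j % (2 * m) = 2 * m - v i % (2 * m) := by
    lia
  rcases hcases with h | h
  · exact h1 ⟨v j / (2 * m) - v i / (2 * m), by linear_combination h - ej + ei⟩
  · exact h2 ⟨1 + v j / (2 * m) + v i / (2 * m), by linear_combination h - ej - ei⟩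

/-- §6.2: for even degree `n = 2m` with `m ≤ r` there are no
`Y_{Q,n}^{sc}`-free orbits for `Spin_{2r+1}^{(n)}`. -/
theorem stmt15 (r m : ℕ) (hr : 2 ≤ r) (hm1 : 1 ≤ m) (hm2 : m ≤ r)
    (v : Fin r → ℤ) (hv : Even (∑ i, v i + ((r * (r + 1) / 2 : ℕ) : ℤ))) :
    ∃ (σ : Equiv.Perm (Fin r)) (ε : Fin r → ℤ),
      (∀ i, ε i = 1 ∨ ε i = -1) ∧ ¬ (σ = 1 ∧ ∀ i, ε i = 1) ∧
      ∀ i, (2 * (m : ℤ)) ∣ ε i * v (σ i) - v i := by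
  rcases exists_dvd_or_exists_ne_dvd_sub_or_dvd_add hm1 (by simpa using hm2) v with
    ⟨i, hi⟩ | ⟨i, j, hij, h⟩
  · refine ⟨1, fun k => if k = i then -1 else 1, fun k => ?_, fun h => ?_, fun k => ?_⟩
    · by_cases hk : k = i <;> simp [hk]
    · simpa using h.2 i
    · by_cases hk : k = i
      · obtain ⟨c, hc⟩ := hi
        refine ⟨-c, ?_⟩
        simp only [hk, if_true, Equiv.Perm.one_apply]
        linear_combination -2 * hc
      · simp [hk]
  · obtain ⟨s, hs, hsd⟩ : ∃ s : ℤ, (s = 1 ∨ s = -1) ∧ (2 * (m : ℤ)) ∣ s * v j - v i := by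
      rcases h with h | h
      · exact ⟨1, Or.inl rfl, by simpa using h⟩
      · exact ⟨-1, Or.inr rfl, by
          rwa [← dvd_neg, show -(-1 * v j - v i) = v j + v i by ring]⟩
    have hss : s * s = 1 := by rcases hs with rfl | rfl <;> norm_num
    refine ⟨Equiv.swap i j, fun k => if k = i ∨ k = j then s else 1, fun k => ?_,
      fun h => hij (Equiv.swap_eq_one_iff.mp h.1), fun k => ?_⟩
    · by_cases hk : k = i ∨ k = j <;> simp [hk, hs]
    · by_cases hi : k = i
      · simpa [hi] using hsd
      · by_cases hj : k = j
        · obtain ⟨c, hc⟩ := hsd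
          refine ⟨-s * c, ?_⟩
          simp only [hj, or_true, if_true, Equiv.swap_apply_right]
          linear_combination -s * hc + v j * hss
        · simp [hi, hj, Equiv.swap_apply_of_ne_of_ne hi hj]
end

section
/- Let r ≥ 2, m = r + 1, n = 2r + 2, and let v* : Fin r → ℤ be given by v* i = i + 1, so v* = (1, 2, …, r). Then: (a) for every nontrivial signed permutation (σ, ε) of Fin r there exists some i with n ∤ (ε i · v* (σ i) − v* i); (b) for every v : Fin r → ℤ with Σ_i v i + r(r+1)/2 even such that for every nontrivial signed permutation (σ, ε) there exists some i with n ∤ (ε i · v (σ i) − v i), there exists a signed permutation (σ, ε) with n ∣ (ε i · v (σ i) − (i+1)) for all i; (c) there exists a nontrivial signed permutation (σ, ε) such that ε i · v* (σ i) − v* i = −m for every i. -/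
/-- An integer not congruent to its own negative modulo `2r + 2` is, up to sign, congruent to one
of `1, …, r`. -/
theorem exists_sign_dvd_sub_fin {r : ℕ} {x : ℤ} (hx : ¬ (2 * (r : ℤ) + 2) ∣ -1 * x - x) :
    ∃ (s : ℤ) (a : Fin r), (s = 1 ∨ s = -1) ∧
      (2 * (r : ℤ) + 2) ∣ s * x - (((a : ℕ) : ℤ) + 1) := by
  have hpos : (0 : ℤ) < 2 * (r : ℤ) + 2 := by positivity
  have h0 := Int.emod_nonneg x hpos.ne'
  have h1 := Int.emod_lt_of_pos x hpos
  have hq := Int.emod_add_mul_ediv x (2 * (r : ℤ) + 2)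
  set q := x / (2 * (r : ℤ) + 2)
  set t := x % (2 * (r : ℤ) + 2)
  have ht0 : t ≠ 0 := fun h => hx ⟨-2 * q, by rw [← hq, h]; ring⟩
  have htm : t ≠ r + 1 := fun h => hx ⟨-2 * q - 1, by rw [← hq, h]; ring⟩
  by_cases hlt : t < r + 1
  · refine ⟨1, ⟨(t - 1).toNat, by omega⟩, Or.inl rfl, q, ?_⟩
    rw [Int.toNat_of_nonneg (by omega)]
    linarith
  · refine ⟨-1, ⟨(2 * r + 1 - t).toNat, by omega⟩, Or.inr rfl, -q - 1, ?_⟩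
    rw [Int.toNat_of_nonneg (by omega)]
    linarith

/-- A vector fixed modulo `n` by no nontrivial signed permutation has no entry congruent to its
own negative. -/
theorem not_dvd_neg_sub_of_free {r : ℕ} {n : ℤ} {v : Fin r → ℤ}
    (hfree : ∀ (σ : Equiv.Perm (Fin r)) (ε : Fin r → ℤ),
      (∀ i, ε i = 1 ∨ ε i = -1) → ¬ (σ = 1 ∧ ∀ i, ε i = 1) →
      ∃ i, ¬ n ∣ ε i * v (σ i) - v i) (i : Fin r) :
    ¬ n ∣ -1 * v i - v i := by
  intro h
  obtain ⟨k, hk⟩ := hfree 1 (fun k => if k = i then -1 else 1)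
    (fun k => by split_ifs <;> simp)
    (fun hc => by simpa using hc.2 i)
  by_cases hki : k = i
  · subst hki
    exact hk (by simpa using h)
  · exact hk (by simp [hki])

/-- A vector fixed modulo `n` by no nontrivial signed permutation has entries that are pairwise
incongruent up to sign. -/
theorem eq_of_dvd_sign_mul_sub_of_free {r : ℕ} {n : ℤ} {v : Fin r → ℤ}
    (hfree : ∀ (σ : Equiv.Perm (Fin r)) (ε : Fin r → ℤ),
      (∀ i, ε i = 1 ∨ ε i = -1) → ¬ (σ = 1 ∧ ∀ i, ε i = 1) →
      ∃ i, ¬ n ∣ ε i * v (σ i) - v i)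
    {i j : Fin r} {s : ℤ} (hs : s = 1 ∨ s = -1) (h : n ∣ s * v i - v j) : i = j := by
  by_contra hij
  have h' : n ∣ s * v j - v i := by
    rcases hs with rfl | rfl
    · exact (dvd_neg.2 h).trans (dvd_of_eq (by ring))
    · exact h.trans (dvd_of_eq (by ring))
  obtain ⟨k, hk⟩ := hfree (Equiv.swap i j) (fun k => if k = i ∨ k = j then s else 1)
    (fun k => by split_ifs <;> simp [hs])
    (fun hc => hij (Equiv.swap_eq_one_iff.1 hc.1))
  by_cases hki : k = i
  · subst hki
    exact hk (by simpa using h')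
  · by_cases hkj : k = j
    · subst hkj
      exact hk (by simpa using h)
    · exact hk (by simp [hki, hkj, Equiv.swap_apply_of_ne_of_ne])


/-- §6.2, `m = r + 1`, `n = 2r + 2`: (a) the orbit of `v* = (1, 2, …, r)` is
`Y_{Q,n}^{sc}`-free; (b) every `Y_{Q,n}^{sc}`-free orbit is equivalent to that
of `v*`; (c) the orbit of `v*` is not `Y_{Q,n}`-free: some nontrivial signed
permutation shifts `v*` by the constant vector `−m`. -/
theorem stmt16 (r : ℕ) (hr : 2 ≤ r) :
    (∀ (σ : Equiv.Perm (Fin r)) (ε : Fin r → ℤ),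
      (∀ i, ε i = 1 ∨ ε i = -1) → ¬ (σ = 1 ∧ ∀ i, ε i = 1) →
      ∃ i : Fin r, ¬ (2 * (r : ℤ) + 2) ∣
        ε i * (((σ i : ℕ) : ℤ) + 1) - (((i : ℕ) : ℤ) + 1)) ∧
    (∀ v : Fin r → ℤ, Even (∑ i, v i + ((r * (r + 1) / 2 : ℕ) : ℤ)) →
      (∀ (σ : Equiv.Perm (Fin r)) (ε : Fin r → ℤ),
        (∀ i, ε i = 1 ∨ ε i = -1) → ¬ (σ = 1 ∧ ∀ i, ε i = 1) →
        ∃ i, ¬ (2 * (r : ℤ) + 2) ∣ ε i * v (σ i) - v i) →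
      ∃ (σ : Equiv.Perm (Fin r)) (ε : Fin r → ℤ),
        (∀ i, ε i = 1 ∨ ε i = -1) ∧
        ∀ i, (2 * (r : ℤ) + 2) ∣ ε i * v (σ i) - (((i : ℕ) : ℤ) + 1)) ∧
    (∃ (σ : Equiv.Perm (Fin r)) (ε : Fin r → ℤ),
      (∀ i, ε i = 1 ∨ ε i = -1) ∧ ¬ (σ = 1 ∧ ∀ i, ε i = 1) ∧
      ∀ i, ε i * (((σ i : ℕ) : ℤ) + 1) - (((i : ℕ) : ℤ) + 1) = -((r : ℤ) + 1)) := by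
  refine ⟨fun σ ε hε hne => ?_, fun v _ hfree => ?_, ?_⟩
  · by_contra! h
    have key : ∀ i, σ i = i ∧ ε i = 1 := fun i => by
      have hd := h i
      have hi := i.isLt
      have hσ := (σ i).isLt
      rcases hε i with he | he
      · rw [he] at hd
        have := Int.eq_zero_of_abs_lt_dvd hd (by rw [abs_lt]; constructor <;> omega)
        exact ⟨Fin.ext (by omega), he⟩
      · rw [he] at hd
        have := Int.eq_zero_of_abs_lt_dvd hd (by rw [abs_lt]; constructor <;> omega)
        omega
    exact hne ⟨Equiv.ext fun i => (key i).1, fun i => (key i).2⟩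
  · choose s a hs ha using fun i => exists_sign_dvd_sub_fin (not_dvd_neg_sub_of_free hfree i)
    have hinj : Function.Injective a := fun i j hij => by
      have hd : (2 * (r : ℤ) + 2) ∣ s i * v i - s j * v j := by
        have := dvd_sub (ha i) (ha j)
        rw [hij] at this
        simpa using this
      have hjj : s j * s j = 1 := by rcases hs j with h | h <;> simp [h]
      refine eq_of_dvd_sign_mul_sub_of_free hfree (s := s j * s i) ?_ ?_
      · rcases hs i with h | h <;> rcases hs j with h' | h' <;> simp [h, h']
      · exact (hd.mul_left (s j)).trans (dvd_of_eq (by linear_combination -v j * hjj))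
    let e := Equiv.ofBijective a (Finite.injective_iff_bijective.1 hinj)
    refine ⟨e.symm, fun i => s (e.symm i), fun i => hs _, fun i => ?_⟩
    have h := ha (e.symm i)
    rwa [show a (e.symm i) = i from e.apply_symm_apply i] at h
  · refine ⟨Fin.revPerm, fun _ => -1, fun _ => Or.inr rfl, fun h => ?_, fun i => ?_⟩
    · exact absurd (h.2 ⟨0, by omega⟩) (by norm_num)
    · simp only [Fin.revPerm_apply, Fin.val_rev]
      omega
end

section
/- Let L = {v : Fin 3 → ℤ : v 0 + v 1 + v 2 = 0}, let W be the group of linear automorphisms of ℤ³ generated by w₁ : (y₁,y₂,y₃) ↦ (y₂,y₁,y₃) and w₂ : (y₁,y₂,y₃) ↦ (−y₁,−y₃,−y₂), and let D₇ = {u ∈ L : 7 ∣ (u i − u j) for all i, j}. Let v* = (−2, −1, 3) ∈ L. Then: (a) if w ∈ W satisfies w(v*) − v* ∈ D₇, then w = 1; (b) for every v ∈ L such that w(v) − v ∉ D₇ for all w ∈ W with w ≠ 1, there exists w ∈ W with w(v) − v* ∈ D₇. -/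
/-- Membership in `D_n = {u ∈ L : n ∣ (u i − u j) for all i, j}`, where
`L = {v : Fin 3 → ℤ : v 0 + v 1 + v 2 = 0}`. -/
def memD (n : ℕ) (u : Fin 3 → ℤ) : Prop :=
  u 0 + u 1 + u 2 = 0 ∧ ∀ i j, (n : ℤ) ∣ u i - u j

/-- `v* = (−2, −1, 3)`. -/
def vG : Fin 3 → ℤ := ![-2, -1, 3]

/-- The linear automorphism `w` acts as the permutation `σ` of the coordinates times the sign `s`. -/
def ActsAs (w : (Fin 3 → ℤ) ≃ₗ[ℤ] (Fin 3 → ℤ)) (σ : Equiv.Perm (Fin 3)) (s : ℤˣ) : Prop :=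
  ∀ v i, w v i = s * v (σ i)

lemma ActsAs.one : ActsAs 1 1 1 := fun v i => by simp

lemma ActsAs.mul {w w' : (Fin 3 → ℤ) ≃ₗ[ℤ] (Fin 3 → ℤ)} {σ σ' : Equiv.Perm (Fin 3)} {s s' : ℤˣ}
    (h : ActsAs w σ s) (h' : ActsAs w' σ' s') : ActsAs (w * w') (σ' * σ) (s * s') := fun v i => by
  rw [LinearEquiv.mul_apply, h, h']
  simp [mul_assoc]

lemma ActsAs.inv {w : (Fin 3 → ℤ) ≃ₗ[ℤ] (Fin 3 → ℤ)} {σ : Equiv.Perm (Fin 3)} {s : ℤˣ}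
    (h : ActsAs w σ s) : ActsAs w⁻¹ σ⁻¹ s⁻¹ := fun v i => by
  have h₁ := h (w⁻¹ v) (σ⁻¹ i)
  rw [← LinearEquiv.mul_apply, mul_inv_cancel, LinearEquiv.coe_one, id_eq,
    ← Equiv.Perm.mul_apply, mul_inv_cancel, Equiv.Perm.one_apply] at h₁
  rw [h₁, ← mul_assoc, Units.inv_mul, one_mul]

lemma ActsAs.eq_one {w : (Fin 3 → ℤ) ≃ₗ[ℤ] (Fin 3 → ℤ)} (h : ActsAs w 1 1) : w = 1 := by
  ext v i
  simp [h _ i]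

lemma ActsAs.sum_apply {w : (Fin 3 → ℤ) ≃ₗ[ℤ] (Fin 3 → ℤ)} {σ : Equiv.Perm (Fin 3)} {s : ℤˣ}
    (h : ActsAs w σ s) (v : Fin 3 → ℤ) : ∑ i, w v i = s * ∑ i, v i := by
  simp only [h v, ← Finset.mul_sum, Equiv.sum_comp]

lemma memD_seven_iff {u : Fin 3 → ℤ} (hu : u 0 + u 1 + u 2 = 0) :
    memD 7 u ↔ ∀ i, (u i : ZMod 7) = 0 := by
  simp only [ZMod.intCast_zmod_eq_zero_iff_dvd, memD, Fin.forall_fin_succ]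
  simp
  omega

lemma ActsAs.memD_sub_iff {w : (Fin 3 → ℤ) ≃ₗ[ℤ] (Fin 3 → ℤ)} {σ : Equiv.Perm (Fin 3)} {s : ℤˣ}
    (h : ActsAs w σ s) {v v' : Fin 3 → ℤ} (hv : v 0 + v 1 + v 2 = 0)
    (hv' : v' 0 + v' 1 + v' 2 = 0) :
    memD 7 (w v - v') ↔ ∀ i, ((s : ℤ) : ZMod 7) * (v (σ i) : ZMod 7) = (v' i : ZMod 7) := by
  have hs := h.sum_apply v
  simp only [Fin.sum_univ_three, hv, mul_zero] at hs
  rw [memD_seven_iff (by simp only [Pi.sub_apply]; omega)]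
  simp [h v, sub_eq_zero]

lemma exists_actsAs_of_mem_closure {w₁ w₂ w : (Fin 3 → ℤ) ≃ₗ[ℤ] (Fin 3 → ℤ)}
    (h₁ : ActsAs w₁ (Equiv.swap 0 1) 1) (h₂ : ActsAs w₂ (Equiv.swap 1 2) (-1))
    (hw : w ∈ Subgroup.closure ({w₁, w₂} : Set ((Fin 3 → ℤ) ≃ₗ[ℤ] (Fin 3 → ℤ)))) :
    ∃ σ s, ActsAs w σ s := by
  induction hw using Subgroup.closure_induction with
  | mem x hx =>
    rcases hx with rfl | rfl
    exacts [⟨_, _, h₁⟩, ⟨_, _, h₂⟩]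
  | one => exact ⟨_, _, ActsAs.one⟩
  | mul x y _ _ hx hy =>
    obtain ⟨_, _, hx⟩ := hx
    obtain ⟨_, _, hy⟩ := hy
    exact ⟨_, _, hx.mul hy⟩
  | inv x _ hx =>
    obtain ⟨_, _, hx⟩ := hx
    exact ⟨_, _, hx.inv⟩

/-- The twelve signed permutations are the elements `(w₁ w₂)ᵏ` and `(w₁ w₂)ᵏ w₁`. -/
lemma exists_word (σ : Equiv.Perm (Fin 3)) (s : ℤˣ) :
    ∃ k : Fin 6, ∃ l : Fin 2,
      σ = Equiv.swap 0 1 ^ (l : ℕ) * (Equiv.swap 1 2 * Equiv.swap 0 1) ^ (k : ℕ) ∧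
        s = (1 * -1) ^ (k : ℕ) * 1 ^ (l : ℕ) := by
  revert σ s
  decide +kernel

lemma ActsAs.pow {w : (Fin 3 → ℤ) ≃ₗ[ℤ] (Fin 3 → ℤ)} {σ : Equiv.Perm (Fin 3)} {s : ℤˣ}
    (h : ActsAs w σ s) (k : ℕ) : ActsAs (w ^ k) (σ ^ k) (s ^ k) := by
  induction k with
  | zero => simpa only [pow_zero] using ActsAs.one
  | succ k ih =>
    rw [pow_succ, pow_succ' σ, pow_succ s]
    exact ih.mul h

lemma exists_mem_closure_actsAs {w₁ w₂ : (Fin 3 → ℤ) ≃ₗ[ℤ] (Fin 3 → ℤ)}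
    (h₁ : ActsAs w₁ (Equiv.swap 0 1) 1) (h₂ : ActsAs w₂ (Equiv.swap 1 2) (-1))
    (σ : Equiv.Perm (Fin 3)) (s : ℤˣ) :
    ∃ w ∈ Subgroup.closure ({w₁, w₂} : Set ((Fin 3 → ℤ) ≃ₗ[ℤ] (Fin 3 → ℤ))), ActsAs w σ s := by
  obtain ⟨k, l, rfl, rfl⟩ := exists_word σ s
  have hm₁ : w₁ ∈ Subgroup.closure ({w₁, w₂} : Set ((Fin 3 → ℤ) ≃ₗ[ℤ] (Fin 3 → ℤ))) :=
    Subgroup.subset_closure (by simp)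
  have hm₂ : w₂ ∈ Subgroup.closure ({w₁, w₂} : Set ((Fin 3 → ℤ) ≃ₗ[ℤ] (Fin 3 → ℤ))) :=
    Subgroup.subset_closure (by simp)
  exact ⟨(w₁ * w₂) ^ (k : ℕ) * w₁ ^ (l : ℕ),
    mul_mem (pow_mem (mul_mem hm₁ hm₂) _) (pow_mem hm₁ _), ((h₁.mul h₂).pow k).mul (h₁.pow l)⟩

lemma eq_one_of_smul_vG_eq (σ : Equiv.Perm (Fin 3)) (s : ℤˣ)
    (h : ∀ i, ((s : ℤ) : ZMod 7) * (vG (σ i) : ZMod 7) = (vG i : ZMod 7)) : σ = 1 ∧ s = 1 := by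
  revert σ s
  decide +kernel

lemma exists_smul_eq_vG_of_free (a b : ZMod 7)
    (h : ∀ (σ : Equiv.Perm (Fin 3)) (s : ℤˣ), ¬(σ = 1 ∧ s = 1) →
      ¬∀ i, ((s : ℤ) : ZMod 7) * ![a, b, -a - b] (σ i) = ![a, b, -a - b] i) :
    ∃ (σ : Equiv.Perm (Fin 3)) (s : ℤˣ),
      ∀ i, ((s : ℤ) : ZMod 7) * ![a, b, -a - b] (σ i) = (vG i : ZMod 7) := by
  revert a b
  decide +kernel

lemma ActsAs.unique_one {σ : Equiv.Perm (Fin 3)} {s : ℤˣ} (h : ActsAs 1 σ s) : σ = 1 ∧ s = 1 :=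
  eq_one_of_smul_vG_eq σ s fun i => by
    have := h vG i
    rw [LinearEquiv.coe_one, id_eq] at this
    exact_mod_cast (congrArg (Int.cast : ℤ → ZMod 7) this).symm

/-- Theorem 7.1 for `n = 7`: the `W(G₂)`-orbit of `v* = (−2, −1, 3)` is
`Y_{Q,7}`-free (a), and every `Y_{Q,7}`-free element of `L` is
`W`-equivalent to `v*` modulo `Y_{Q,7}` (b). -/
theorem stmt17 (w₁ w₂ : (Fin 3 → ℤ) ≃ₗ[ℤ] (Fin 3 → ℤ))
    (hw₁ : ∀ v : Fin 3 → ℤ, w₁ v = ![v 1, v 0, v 2])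
    (hw₂ : ∀ v : Fin 3 → ℤ, w₂ v = ![-v 0, -v 2, -v 1]) :
    (∀ w ∈ Subgroup.closure ({w₁, w₂} : Set ((Fin 3 → ℤ) ≃ₗ[ℤ] (Fin 3 → ℤ))),
      memD 7 (w vG - vG) → w = 1) ∧
    (∀ v : Fin 3 → ℤ, v 0 + v 1 + v 2 = 0 →
      (∀ w ∈ Subgroup.closure ({w₁, w₂} : Set ((Fin 3 → ℤ) ≃ₗ[ℤ] (Fin 3 → ℤ))),
        w ≠ 1 → ¬ memD 7 (w v - v)) →
      ∃ w ∈ Subgroup.closure ({w₁, w₂} : Set ((Fin 3 → ℤ) ≃ₗ[ℤ] (Fin 3 → ℤ))),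
        memD 7 (w v - vG)) := by
  have h₁ : ActsAs w₁ (Equiv.swap 0 1) 1 := fun v i => by
    rw [hw₁]
    fin_cases i <;> simp [Equiv.swap_apply_def]
  have h₂ : ActsAs w₂ (Equiv.swap 1 2) (-1) := fun v i => by
    rw [hw₂]
    fin_cases i <;> simp [Equiv.swap_apply_def]
  have hG : vG 0 + vG 1 + vG 2 = 0 := by decide
  refine ⟨fun w hw hD => ?_, fun v hv hfree => ?_⟩
  · obtain ⟨σ, s, h⟩ := exists_actsAs_of_mem_closure h₁ h₂ hw
    obtain ⟨rfl, rfl⟩ := eq_one_of_smul_vG_eq σ s ((h.memD_sub_iff hG hG).1 hD)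
    exact h.eq_one
  · have hcast : ∀ i, (v i : ZMod 7) = ![(v 0 : ZMod 7), v 1, -v 0 - v 1] i := by
      have h2 : v 2 = -v 0 - v 1 := by omega
      intro i
      fin_cases i <;> simp [h2]
    obtain ⟨σ, s, h⟩ := exists_smul_eq_vG_of_free (v 0) (v 1) fun σ s hne hfix => by
      obtain ⟨w, hw, h⟩ := exists_mem_closure_actsAs h₁ h₂ σ s
      refine hfree w hw (fun h1 => hne (h1 ▸ h).unique_one) ((h.memD_sub_iff hv hv).2 fun i => ?_)
      rw [hcast (σ i), hcast i]
      exact hfix i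
    obtain ⟨w, hw, hws⟩ := exists_mem_closure_actsAs h₁ h₂ σ s
    exact ⟨w, hw, (hws.memD_sub_iff hv hG).2 fun i => by rw [hcast (σ i), h i]⟩
end

section
/- Let L = {v : Fin 3 → ℤ : v 0 + v 1 + v 2 = 0}, let W be the group of linear automorphisms of ℤ³ generated by w₁ : (y₁,y₂,y₃) ↦ (y₂,y₁,y₃) and w₂ : (y₁,y₂,y₃) ↦ (−y₁,−y₃,−y₂), and let D₁₂ = {u ∈ L : 12 ∣ (u i − u j) for all i, j}. Let v* = (−2, −1, 3) ∈ L. Then: (a) if w ∈ W satisfies w(v*) − v* ∈ D₁₂, then w = 1; (b) for every v ∈ L such that w(v) − v ∉ D₁₂ for all w ∈ W with w ≠ 1, there exists w ∈ W with w(v) − v* ∈ D₁₂. -/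
/-- The signed-permutation action of `ℤˣ × S₃` on triples in a commutative ring. -/
def signedPerm {R : Type*} [CommRing R] (g : ℤˣ × Equiv.Perm (Fin 3))
    (v : Fin 3 → R) : Fin 3 → R :=
  fun i => ((g.1 : ℤ) : R) * v (g.2⁻¹ i)

/-- The signed-permutation action on `ℤ³` as a homomorphism to linear automorphisms. -/
def signedPermHom : ℤˣ × Equiv.Perm (Fin 3) →* ((Fin 3 → ℤ) ≃ₗ[ℤ] (Fin 3 → ℤ)) where
  toFun g :=
    { toFun := signedPerm g
      invFun := signedPerm g⁻¹
      map_add' := fun v w => by ext i; simp [signedPerm, mul_add]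
      map_smul' := fun c v => by ext i; simp [signedPerm, mul_left_comm]
      left_inv := fun v => by
        ext i
        simp [signedPerm, ← mul_assoc, ← Units.val_mul]
      right_inv := fun v => by
        ext i
        simp [signedPerm, ← mul_assoc, ← Units.val_mul] }
  map_one' := by ext v i; simp [signedPerm]
  map_mul' g h := by ext v i; simp [signedPerm, mul_assoc]

@[simp]
theorem signedPermHom_apply (g : ℤˣ × Equiv.Perm (Fin 3)) (v : Fin 3 → ℤ) :
    signedPermHom g v = signedPerm g v := rfl

theorem closure_signedPerm_generators :
    Subgroup.closure ({(1, Equiv.swap 0 1), (-1, Equiv.swap 1 2)} :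
      Set (ℤˣ × Equiv.Perm (Fin 3))) = ⊤ := by
  rw [eq_top_iff]
  intro g _
  have words : ∀ g : ℤˣ × Equiv.Perm (Fin 3), ∃ k : Fin 6, ∃ e : Fin 2,
      g = (((1, Equiv.swap 0 1) : ℤˣ × Equiv.Perm (Fin 3)) * (-1, Equiv.swap 1 2)) ^ (k : ℕ) *
        (1, Equiv.swap 0 1) ^ (e : ℕ) := by decide
  obtain ⟨k, e, rfl⟩ := words g
  have h₁ := Subgroup.subset_closure (Set.mem_insert ((1, Equiv.swap 0 1) :
    ℤˣ × Equiv.Perm (Fin 3)) {(-1, Equiv.swap 1 2)})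
  have h₂ := Subgroup.subset_closure (Set.mem_insert_of_mem ((1, Equiv.swap 0 1) :
    ℤˣ × Equiv.Perm (Fin 3)) (Set.mem_singleton (-1, Equiv.swap 1 2)))
  exact mul_mem (pow_mem (mul_mem h₁ h₂) _) (pow_mem h₁ _)

theorem sum_signedPerm (g : ℤˣ × Equiv.Perm (Fin 3)) {v : Fin 3 → ℤ}
    (hv : v 0 + v 1 + v 2 = 0) :
    signedPerm g v 0 + signedPerm g v 1 + signedPerm g v 2 = 0 := by
  rw [← Fin.sum_univ_three] at hv ⊢
  simp only [signedPerm, ← Finset.mul_sum]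
  rw [Equiv.sum_comp g.2⁻¹ v, hv, mul_zero]

theorem memD_signedPerm_sub_iff (n : ℕ) (g : ℤˣ × Equiv.Perm (Fin 3)) {v w : Fin 3 → ℤ}
    (hv : v 0 + v 1 + v 2 = 0) (hw : w 0 + w 1 + w 2 = 0) :
    memD n (signedPerm g v - w) ↔
      ∀ i j, signedPerm g (fun k => (v k : ZMod n)) i - w i =
        signedPerm g (fun k => (v k : ZMod n)) j - w j := by
  have hsum : (signedPerm g v - w) 0 + (signedPerm g v - w) 1 + (signedPerm g v - w) 2 = 0 := by
    have := sum_signedPerm g hv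
    simp only [Pi.sub_apply]
    linarith
  rw [memD, and_iff_right hsum]
  simp only [← ZMod.intCast_zmod_eq_zero_iff_dvd, signedPerm, Pi.sub_apply]
  push_cast
  simp only [sub_eq_zero]

theorem eq_one_of_signedPerm_vG (g : ℤˣ × Equiv.Perm (Fin 3))
    (h : ∀ i j, signedPerm g (fun k => (vG k : ZMod 12)) i - vG i =
      signedPerm g (fun k => (vG k : ZMod 12)) j - vG j) : g = 1 := by
  revert g
  decide

theorem exists_signedPerm_eq_vG (a b : ZMod 12)
    (h : ∀ g : ℤˣ × Equiv.Perm (Fin 3), g ≠ 1 →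
      ¬ ∀ i j, signedPerm g ![a, b, -a - b] i - ![a, b, -a - b] i =
        signedPerm g ![a, b, -a - b] j - ![a, b, -a - b] j) :
    ∃ g : ℤˣ × Equiv.Perm (Fin 3), ∀ i j, signedPerm g ![a, b, -a - b] i - vG i =
      signedPerm g ![a, b, -a - b] j - vG j := by
  revert a b
  decide +kernel

/-- Theorem 7.1 for `n = 12`: the `W(G₂)`-orbit of `v* = (−2, −1, 3)` is
`Y_{Q,12}`-free (a), and every `Y_{Q,12}`-free element of `L` is
`W`-equivalent to `v*` modulo `Y_{Q,12}` (b). -/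
theorem stmt18 (w₁ w₂ : (Fin 3 → ℤ) ≃ₗ[ℤ] (Fin 3 → ℤ))
    (hw₁ : ∀ v : Fin 3 → ℤ, w₁ v = ![v 1, v 0, v 2])
    (hw₂ : ∀ v : Fin 3 → ℤ, w₂ v = ![-v 0, -v 2, -v 1]) :
    (∀ w ∈ Subgroup.closure ({w₁, w₂} : Set ((Fin 3 → ℤ) ≃ₗ[ℤ] (Fin 3 → ℤ))),
      memD 12 (w vG - vG) → w = 1) ∧
    (∀ v : Fin 3 → ℤ, v 0 + v 1 + v 2 = 0 →
      (∀ w ∈ Subgroup.closure ({w₁, w₂} : Set ((Fin 3 → ℤ) ≃ₗ[ℤ] (Fin 3 → ℤ))),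
        w ≠ 1 → ¬ memD 12 (w v - v)) →
      ∃ w ∈ Subgroup.closure ({w₁, w₂} : Set ((Fin 3 → ℤ) ≃ₗ[ℤ] (Fin 3 → ℤ))),
        memD 12 (w v - vG)) := by
  have hgen₁ : signedPermHom (1, Equiv.swap 0 1) = w₁ := by
    refine LinearEquiv.ext fun v => ?_
    rw [hw₁]
    funext i
    fin_cases i <;> simp [signedPerm, Equiv.swap_apply_def]
  have hgen₂ : signedPermHom (-1, Equiv.swap 1 2) = w₂ := by
    refine LinearEquiv.ext fun v => ?_
    rw [hw₂]
    funext i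
    fin_cases i <;> simp [signedPerm, Equiv.swap_apply_def]
  have hrange : Subgroup.closure {w₁, w₂} = signedPermHom.range := by
    rw [← hgen₁, ← hgen₂, ← Set.image_pair, ← MonoidHom.map_closure,
      closure_signedPerm_generators, MonoidHom.range_eq_map]
  have hvG : vG 0 + vG 1 + vG 2 = 0 := by decide
  have hfree : ∀ g, memD 12 (signedPermHom g vG - vG) → g = 1 := fun g hg =>
    eq_one_of_signedPerm_vG g ((memD_signedPerm_sub_iff 12 g hvG hvG).1 hg)
  rw [hrange]
  refine ⟨?_, fun v hv hvfree => ?_⟩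
  · rintro _ ⟨g, rfl⟩ hg
    rw [hfree g hg, map_one]
  · have hcast : (fun k => (v k : ZMod 12)) =
        ![(v 0 : ZMod 12), (v 1 : ZMod 12), -(v 0 : ZMod 12) - (v 1 : ZMod 12)] := by
      have hv₂ : v 2 = -v 0 - v 1 := by linarith
      funext i
      fin_cases i <;> simp [hv₂]
    obtain ⟨g, hg⟩ := exists_signedPerm_eq_vG (v 0) (v 1) fun g hg hfix => by
      refine hvfree (signedPermHom g) ⟨g, rfl⟩ (fun h => hg (hfree g ?_)) ?_
      · rw [h]
        simp [memD]
      · refine (memD_signedPerm_sub_iff 12 g hv hv).2 ?_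
        rw [← hcast] at hfix
        exact hfix
    refine ⟨signedPermHom g, ⟨g, rfl⟩, (memD_signedPerm_sub_iff 12 g hv hvG).2 ?_⟩
    rw [← hcast] at hg
    exact hg
end

section
/- Let L = {v : Fin 3 → ℤ : v 0 + v 1 + v 2 = 0}, let W be the group of linear automorphisms of ℤ³ generated by w₁ : (y₁,y₂,y₃) ↦ (y₂,y₁,y₃) and w₂ : (y₁,y₂,y₃) ↦ (−y₁,−y₃,−y₂), and for an integer n ≥ 1 let D_n = {u ∈ L : n ∣ (u i − u j) for all i, j}. Then for every n ∈ {1, 2, 3, 4, 5, 6, 9} and every v ∈ L there exists w ∈ W with w ≠ 1 and w(v) − v ∈ D_n. -/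
theorem exists_dvd_sub_or_dvd_three_mul {n : ℕ} (hn : n ∈ ({1, 2, 3, 4, 5, 6, 9} : Finset ℕ))
    {a b c : ℤ} (h : a + b + c = 0) :
    (n : ℤ) ∣ a - b ∨ (n : ℤ) ∣ a - c ∨ (n : ℤ) ∣ b - c ∨
      (n : ℤ) ∣ 3 * a ∨ (n : ℤ) ∣ 3 * b ∨ (n : ℤ) ∣ 3 * c := by
  obtain rfl : c = -a - b := by omega
  simp only [← ZMod.intCast_zmod_eq_zero_iff_dvd]
  push_cast
  generalize (a : ZMod n) = x
  generalize (b : ZMod n) = y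
  simp only [Finset.mem_insert, Finset.mem_singleton] at hn
  rcases hn with rfl | rfl | rfl | rfl | rfl | rfl | rfl <;> revert x y <;> decide

theorem memD_of_dvd {n : ℕ} {u : Fin 3 → ℤ} (hu : u 0 + u 1 + u 2 = 0)
    (h₁ : (n : ℤ) ∣ u 0 - u 1) (h₂ : (n : ℤ) ∣ u 0 - u 2) : memD n u := by
  refine ⟨hu, fun i j => ?_⟩
  have h (k : Fin 3) : (n : ℤ) ∣ u 0 - u k := by
    fin_cases k
    · simp
    · exact h₁
    · exact h₂
  simpa using dvd_sub (h j) (h i)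

/-- §7: for `n ∈ {1, 2, 3, 4, 5, 6, 9}` there are no `Y_{Q,n}`-free
`W(G₂)`-orbits in `L`. -/
theorem stmt19 (w₁ w₂ : (Fin 3 → ℤ) ≃ₗ[ℤ] (Fin 3 → ℤ))
    (hw₁ : ∀ v : Fin 3 → ℤ, w₁ v = ![v 1, v 0, v 2])
    (hw₂ : ∀ v : Fin 3 → ℤ, w₂ v = ![-v 0, -v 2, -v 1]) :
    ∀ n ∈ ({1, 2, 3, 4, 5, 6, 9} : Finset ℕ),
      ∀ v : Fin 3 → ℤ, v 0 + v 1 + v 2 = 0 →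
        ∃ w ∈ Subgroup.closure ({w₁, w₂} : Set ((Fin 3 → ℤ) ≃ₗ[ℤ] (Fin 3 → ℤ))),
          w ≠ 1 ∧ memD n (w v - v) := by
  intro n hn v hv
  set W := Subgroup.closure ({w₁, w₂} : Set ((Fin 3 → ℤ) ≃ₗ[ℤ] (Fin 3 → ℤ)))
  have m₁ : w₁ ∈ W := Subgroup.subset_closure (by simp)
  have m₂ : w₂ ∈ W := Subgroup.subset_closure (by simp)
  obtain ⟨z, mz, hz⟩ : ∃ z ∈ W, ∀ x, z x = -x := by
    refine ⟨(w₁ * w₂) ^ 3, pow_mem (mul_mem m₁ m₂) 3, fun x => ?_⟩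
    ext i
    fin_cases i <;> simp [pow_succ, hw₁, hw₂]
  have reflect (w : (Fin 3 → ℤ) ≃ₗ[ℤ] (Fin 3 → ℤ)) (hw : w ∈ W)
      (hne : w ![1, 2, 4] ≠ ![1, 2, 4]) (hsum : w v 0 + w v 1 + w v 2 = 0)
      (h₁ : (n : ℤ) ∣ (w v - v) 0 - (w v - v) 1) (h₂ : (n : ℤ) ∣ (w v - v) 0 - (w v - v) 2) :
      ∃ w ∈ W, w ≠ 1 ∧ memD n (w v - v) := by
    refine ⟨w, hw, fun h => hne (by simp [h]), memD_of_dvd ?_ h₁ h₂⟩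
    simp only [Pi.sub_apply]
    omega
  have hv₂ : v 2 = -v 0 - v 1 := by omega
  rcases exists_dvd_sub_or_dvd_three_mul hn hv with ⟨k, h⟩ | ⟨k, h⟩ | ⟨k, h⟩ | ⟨k, h⟩ | ⟨k, h⟩ | ⟨k, h⟩
  · apply reflect w₁ m₁
    · simp [hw₁]
    · simp [hw₁]; omega
    · exact ⟨-2 * k, by simp [hw₁]; linarith⟩
    · exact ⟨-k, by simp [hw₁]; linarith⟩
  · apply reflect (z * w₁ * w₂ * w₁) (mul_mem (mul_mem (mul_mem mz m₁) m₂) m₁)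
    · simp [hw₁, hw₂, hz]
    · simp [hw₁, hw₂, hz]; omega
    · exact ⟨-k, by simp [hw₁, hw₂, hz]; linarith⟩
    · exact ⟨-2 * k, by simp [hw₁, hw₂, hz]; linarith⟩
  · apply reflect (z * w₂) (mul_mem mz m₂)
    · simp [hw₂, hz]
    · simp [hw₂, hz]; omega
    · exact ⟨k, by simp [hw₂, hz]; linarith⟩
    · exact ⟨-k, by simp [hw₂, hz]; linarith⟩
  · apply reflect w₂ m₂
    · simp [hw₂]
    · simp [hw₂]; omega
    · exact ⟨-k, by simp [hw₂]; linarith⟩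
    · exact ⟨-k, by simp [hw₂]; linarith⟩
  · apply reflect (w₁ * w₂ * w₁) (mul_mem (mul_mem m₁ m₂) m₁)
    · simp [hw₁, hw₂]
    · simp [hw₁, hw₂]; omega
    · exact ⟨k, by simp [hw₁, hw₂]; linarith⟩
    · exact ⟨0, by simp [hw₁, hw₂]; linarith⟩
  · apply reflect (z * w₁) (mul_mem mz m₁)
    · simp [hw₁, hz]
    · simp [hw₁, hz]; omega
    · exact ⟨0, by simp [hw₁, hz]; linarith⟩
    · exact ⟨k, by simp [hw₁, hz]; linarith⟩
end
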